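/- The sectional category of the twistor map is exactly 2: ℍP² admits a cover by three open sets on each of which q admits a continuous local section, but it admits no cover by two open sets with this property. -/

import Mathlib

noncomputable section

open Quaternion

/-- The standard inclusion of `ℂ` into the quaternions `ℍ`. -/
def cq (z : ℂ) : ℍ[ℝ] := ⟨z.re, z.im, 0, 0⟩

lemma cq_ne_zero {z : ℂ} (hz : z ≠ 0) : cq z ≠ 0 := by
  intro h
  apply hz
  have h1 : (cq z).re = 0 := by rw [h]; rfl
  have h2 : (cq z).imI = 0 := by rw [h]; rfl
  exact Complex.ext h1 h2

/-- Nonzero vectors of `ℍ³`. -/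
abbrev V3x : Type := {v : Fin 3 → ℍ[ℝ] // v ≠ 0}

/-- Two nonzero vectors of `ℍ³` span the same complex line. -/
def crel (v w : V3x) : Prop := ∃ c : ℂ, c ≠ 0 ∧ w.1 = fun i => v.1 i * cq c

/-- Two nonzero vectors of `ℍ³` span the same quaternionic line. -/
def hrel (v w : V3x) : Prop := ∃ a : ℍ[ℝ], a ≠ 0 ∧ w.1 = fun i => v.1 i * a

/-- `ℂP⁵`, the space of complex lines in `ℍ³ ≅ ℂ⁶`, with the quotient topology. -/
def CP5 : Type := Quot crel

/-- `ℍP²`, the space of quaternionic lines in `ℍ³`, with the quotient topology. -/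
def HP2 : Type := Quot hrel

instance : TopologicalSpace CP5 := instTopologicalSpaceQuot
instance : TopologicalSpace HP2 := instTopologicalSpaceQuot

/-- The twistor map `ℂP⁵ → ℍP²`, sending the complex line spanned by `v` to the
quaternionic line spanned by `v`. -/
def twistor : CP5 → HP2 :=
  Quot.lift (fun v => Quot.mk hrel v)
    (fun _ _ ⟨c, hc, hw⟩ => Quot.sound ⟨cq c, cq_ne_zero hc, hw⟩)

/-- `B` is covered by `k` open sets, on each of which `q : E → B` admits a
continuous local section. -/
def SecatCover {E B : Type*} [TopologicalSpace E] [TopologicalSpace B]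
    (q : E → B) (k : ℕ) : Prop :=
  ∃ U : Fin k → Set B, (∀ i, IsOpen (U i)) ∧ (⋃ i, U i) = Set.univ ∧
    ∀ i, ∃ s : (U i) → E, Continuous s ∧ ∀ x : U i, q (s x) = (x : B)

section Gauss
open MeasureTheory ComplexConjugate

/-- The standard complex Gaussian measure, of density `exp (-‖z‖²) / π`. -/
def gaussC : Measure ℂ :=
  volume.withDensity fun z => ENNReal.ofReal (Real.exp (-‖z‖ ^ 2) / Real.pi)

lemma gaussC_density_measurable :
    Measurable fun z : ℂ => ENNReal.ofReal (Real.exp (-‖z‖ ^ 2) / Real.pi) := by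
  fun_prop

lemma integrable_gaussC_iff (F : ℂ → ℂ) :
    Integrable F gaussC ↔
      Integrable (fun z => ((Real.exp (-‖z‖ ^ 2) / Real.pi : ℝ) : ℂ) * F z) volume := by
  unfold gaussC
  rw [integrable_withDensity_iff_integrable_smul' gaussC_density_measurable (by simp)]
  refine integrable_congr (Filter.Eventually.of_forall fun z => ?_)
  simp only [Complex.real_smul]
  rw [ENNReal.toReal_ofReal (by positivity)]

lemma integral_gaussC (F : ℂ → ℂ) :
    ∫ z, F z ∂gaussC = ∫ z, ((Real.exp (-‖z‖ ^ 2) / Real.pi : ℝ) : ℂ) * F z := by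
  unfold gaussC
  rw [integral_withDensity_eq_integral_toReal_smul gaussC_density_measurable (by simp)]
  refine integral_congr_ae (Filter.Eventually.of_forall fun z => ?_)
  simp only [Complex.real_smul]
  rw [ENNReal.toReal_ofReal (by positivity)]

lemma integral_norm_pow_mul_exp (n : ℕ) :
    ∫ z : ℂ, ‖z‖ ^ n * Real.exp (-‖z‖ ^ 2) = Real.pi * Real.Gamma ((n + 2) / 2) := by
  have h := Complex.integral_rpow_mul_exp_neg_rpow (p := 2) (q := n) (by norm_num)
    (by have : (0 : ℝ) ≤ n := n.cast_nonneg
        linarith)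
  simp only [Real.rpow_natCast, Real.rpow_ofNat] at h
  rw [h]
  ring

lemma integrable_norm_pow_mul_exp (n : ℕ) :
    Integrable (fun z : ℂ => ‖z‖ ^ n * Real.exp (-‖z‖ ^ 2)) := by
  apply Integrable.of_integral_ne_zero
  rw [integral_norm_pow_mul_exp]
  have := Real.Gamma_pos_of_pos (s := ((n : ℝ) + 2) / 2) (by positivity)
  positivity

lemma integrable_gaussC_monomial (a b : ℕ) :
    Integrable (fun z : ℂ => z ^ a * conj z ^ b) gaussC := by
  rw [integrable_gaussC_iff]
  refine ((integrable_norm_pow_mul_exp (a + b)).const_mul (1 / Real.pi)).mono'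
    (by fun_prop) (Filter.Eventually.of_forall fun z => ?_)
  simp only [norm_mul, norm_pow, RCLike.norm_conj, Complex.norm_real, Real.norm_eq_abs]
  rw [abs_of_nonneg (by positivity), pow_add]
  apply le_of_eq
  ring

lemma gaussC_measurePreserving_of_volume {f : ℂ → ℂ} (hf : MeasurePreserving f)
    (he : MeasurableEmbedding f) (hn : ∀ z, ‖f z‖ = ‖z‖) : MeasurePreserving f gaussC gaussC := by
  refine ⟨hf.measurable, ?_⟩
  ext s hs
  rw [Measure.map_apply hf.measurable hs]
  unfold gaussC
  rw [withDensity_apply _ hs, withDensity_apply _ (hf.measurable hs),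
    ← hf.setLIntegral_comp_preimage_emb he
      (fun z => ENNReal.ofReal (Real.exp (-‖z‖ ^ 2) / Real.pi)) s]
  simp only [hn]

lemma gaussC_measurePreserving_linearIsometryEquiv (f : ℂ ≃ₗᵢ[ℝ] ℂ) :
    MeasurePreserving f gaussC gaussC :=
  gaussC_measurePreserving_of_volume f.measurePreserving
    f.toHomeomorph.measurableEmbedding f.norm_map

lemma integral_gaussC_monomial (a b : ℕ) :
    ∫ z : ℂ, z ^ a * conj z ^ b ∂gaussC = if a = b then (a.factorial : ℂ) else 0 := by
  split_ifs with h
  · subst h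
    have h1 := integral_norm_pow_mul_exp (2 * a)
    rw [integral_gaussC]
    have h2 : ∀ z : ℂ, ((Real.exp (-‖z‖ ^ 2) / Real.pi : ℝ) : ℂ) * (z ^ a * conj z ^ a) =
        (((1 / Real.pi) * (‖z‖ ^ (2 * a) * Real.exp (-‖z‖ ^ 2)) : ℝ) : ℂ) := by
      intro z
      have : z ^ a * conj z ^ a = ((‖z‖ ^ (2 * a) : ℝ) : ℂ) := by
        rw [← mul_pow, Complex.mul_conj, Complex.normSq_eq_norm_sq, pow_mul]
        push_cast
        rfl
      rw [this]
      push_cast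
      ring
    simp_rw [h2]
    rw [integral_complex_ofReal, integral_const_mul, h1]
    have h3 : (((2 * a : ℕ) : ℝ) + 2) / 2 = a + 1 := by push_cast; ring
    rw [h3, Real.Gamma_nat_eq_factorial]
    have := Real.pi_ne_zero
    rw [← mul_assoc, one_div, inv_mul_cancel₀ this, one_mul]
    simp
  · set θ : ℝ := Real.pi / ((a : ℝ) - b) with hθ
    have hab : (a : ℝ) - b ≠ 0 := by
      intro h0
      exact h (by exact_mod_cast sub_eq_zero.mp h0)
    have hinv := (gaussC_measurePreserving_linearIsometryEquiv
      (rotation (Circle.exp θ))).integral_comp'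
      (f := (rotation (Circle.exp θ)).toHomeomorph.toMeasurableEquiv)
      (fun z : ℂ => z ^ a * conj z ^ b)
    have hc : (Circle.exp θ : ℂ) ^ a * conj (Circle.exp θ : ℂ) ^ b = -1 := by
      rw [Circle.coe_exp, ← Complex.exp_conj, ← Complex.exp_nat_mul,
        ← Complex.exp_nat_mul, ← Complex.exp_add]
      have : (a : ℂ) * ((θ : ℂ) * Complex.I) + b * (starRingEnd ℂ) ((θ : ℂ) * Complex.I) =
          ((((a : ℝ) - b) * θ : ℝ) : ℂ) * Complex.I := by
        simp only [map_mul, Complex.conj_ofReal, Complex.conj_I]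
        push_cast
        ring
      rw [this, hθ, mul_div_cancel₀ _ hab, Complex.exp_pi_mul_I]
    have h4 : ∀ z : ℂ, (rotation (Circle.exp θ) z) ^ a * conj (rotation (Circle.exp θ) z) ^ b =
        - (z ^ a * conj z ^ b) := by
      intro z
      rw [rotation_apply, map_mul, mul_pow, mul_pow]
      linear_combination (z ^ a * conj z ^ b) * hc
    have h5 : ∫ z, -(z ^ a * conj z ^ b) ∂gaussC = ∫ z, z ^ a * conj z ^ b ∂gaussC := by
      rw [← hinv]
      exact integral_congr_ae (Filter.Eventually.of_forall fun z => (h4 z).symm)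
    rw [integral_neg] at h5
    linear_combination (-1 / 2) * h5

instance : IsFiniteMeasure gaussC := by
  have h := integrable_gaussC_monomial 0 0
  simp only [pow_zero, mul_one] at h
  exact (integrable_const_iff_isFiniteMeasure one_ne_zero).1 h

end Gauss

section Fock
open MeasureTheory ComplexConjugate MvPolynomial

variable {ι : Type} [Fintype ι]

/-- The standard Gaussian measure on `ℂ^ι`. -/
def gaussPi (ι : Type) [Fintype ι] : Measure (ι → ℂ) := Measure.pi fun _ => gaussC

instance : IsFiniteMeasure (gaussPi ι) := by unfold gaussPi; infer_instance

lemma eval_monomial_mul_conj (α β : ι →₀ ℕ) (a b : ℂ) (z : ι → ℂ) :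
    eval z (monomial α a) * conj (eval z (monomial β b)) =
      (a * conj b) * ∏ i, (z i ^ α i * conj (z i) ^ β i) := by
  rw [eval_monomial, eval_monomial, Finsupp.prod_fintype _ _ (by simp),
    Finsupp.prod_fintype _ _ (by simp), Finset.prod_mul_distrib]
  simp only [map_mul, map_prod, map_pow]
  ring

lemma integrable_monomial_mul_conj (α β : ι →₀ ℕ) (a b : ℂ) :
    Integrable (fun z => eval z (monomial α a) * conj (eval z (monomial β b))) (gaussPi ι) := by
  simp_rw [eval_monomial_mul_conj]
  exact (Integrable.fintype_prod (μ := fun _ : ι => gaussC)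
    (f := fun i (z : ℂ) => z ^ α i * conj z ^ β i)
    fun i => integrable_gaussC_monomial _ _).const_mul _

lemma integrable_mul_conj (p q : MvPolynomial ι ℂ) :
    Integrable (fun z => eval z p * conj (eval z q)) (gaussPi ι) := by
  induction p using MvPolynomial.induction_on' with
  | add p p' hp hp' =>
    simp only [map_add, add_mul]
    exact hp.add hp'
  | monomial α a =>
    induction q using MvPolynomial.induction_on' with
    | add q q' hq hq' =>
      simp only [map_add, mul_add]
      exact hq.add hq'
    | monomial β b => exact integrable_monomial_mul_conj α β a b

/-- The Fock inner product of two polynomials. -/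
def fockInner (p q : MvPolynomial ι ℂ) : ℂ := ∫ z, eval z p * conj (eval z q) ∂gaussPi ι

lemma fockInner_add_left (p p' q : MvPolynomial ι ℂ) :
    fockInner (p + p') q = fockInner p q + fockInner p' q := by
  unfold fockInner
  rw [← integral_add (integrable_mul_conj _ _) (integrable_mul_conj _ _)]
  simp only [map_add, add_mul]

lemma fockInner_add_right (p q q' : MvPolynomial ι ℂ) :
    fockInner p (q + q') = fockInner p q + fockInner p q' := by
  unfold fockInner
  rw [← integral_add (integrable_mul_conj _ _) (integrable_mul_conj _ _)]
  simp only [map_add, mul_add]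

lemma fockInner_monomial (α β : ι →₀ ℕ) (a b : ℂ) :
    fockInner (monomial α a) (monomial β b) =
      if α = β then a * conj b * ∏ i, ((α i).factorial : ℂ) else 0 := by
  unfold fockInner
  simp_rw [eval_monomial_mul_conj]
  rw [integral_const_mul]
  unfold gaussPi
  rw [integral_fintype_prod_eq_prod (μ := fun _ : ι => gaussC)
    (f := fun i (z : ℂ) => z ^ α i * conj z ^ β i)]
  simp_rw [integral_gaussC_monomial]
  split_ifs with h
  · subst h; simp
  · obtain ⟨i, hi⟩ : ∃ i, α i ≠ β i := by
      by_contra! hc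
      exact h (Finsupp.ext hc)
    rw [Finset.prod_eq_zero (Finset.mem_univ i) (by simp [hi]), mul_zero]

lemma fockInner_pderiv (i : ι) (p q : MvPolynomial ι ℂ) :
    fockInner (pderiv i p) q = fockInner p (X i * q) := by
  classical
  induction p using MvPolynomial.induction_on' with
  | add p p' hp hp' => rw [map_add, fockInner_add_left, fockInner_add_left, hp, hp']
  | monomial α a =>
    induction q using MvPolynomial.induction_on' with
    | add q q' hq hq' => rw [mul_add, fockInner_add_right, fockInner_add_right, hq, hq']
    | monomial β b =>
      rw [pderiv_monomial, X, monomial_mul, one_mul, fockInner_monomial, fockInner_monomial]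
      by_cases h : α = Finsupp.single i 1 + β
      · subst h
        rw [if_pos rfl, if_pos (by simp)]
        simp only [add_tsub_cancel_left]
        rw [← Finset.mul_prod_erase _ (fun j => ((β j).factorial : ℂ)) (Finset.mem_univ i),
          ← Finset.mul_prod_erase _
            (fun j => (((Finsupp.single i 1 + β : ι →₀ ℕ) j).factorial : ℂ)) (Finset.mem_univ i)]
        have : ∏ x ∈ Finset.univ.erase i, (((Finsupp.single i 1 + β : ι →₀ ℕ) x).factorial : ℂ) =
            ∏ x ∈ Finset.univ.erase i, ((β x).factorial : ℂ) := by
          refine Finset.prod_congr rfl fun x hx => ?_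
          simp [(Finset.ne_of_mem_erase hx).symm]
        rw [this]
        simp only [Finsupp.add_apply, Finsupp.single_eq_same]
        rw [add_comm 1 (β i), Nat.factorial_succ]
        push_cast
        ring
      · rw [if_neg h]
        split_ifs with h'
        · have h0 : α i = 0 := by
            by_contra h0
            apply h
            rw [← h', add_tsub_cancel_of_le]
            simpa [Finsupp.single_le_iff] using Nat.one_le_iff_ne_zero.2 h0
          simp [h0]
        · rfl

lemma integrable_norm_sq_eval (p : MvPolynomial ι ℂ) :
    Integrable (fun z => ‖eval z p‖ ^ 2) (gaussPi ι) := by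
  refine (integrable_mul_conj p p).norm.congr (Filter.Eventually.of_forall fun z => ?_)
  simp [pow_two]

/-- The squared Fock norm of a polynomial. -/
def fockNormSq (p : MvPolynomial ι ℂ) : ℝ := ∫ z, ‖eval z p‖ ^ 2 ∂gaussPi ι

lemma fockNormSq_nonneg (p : MvPolynomial ι ℂ) : 0 ≤ fockNormSq p :=
  integral_nonneg fun _ => by positivity

lemma fockInner_self (p : MvPolynomial ι ℂ) : fockInner p p = fockNormSq p := by
  unfold fockInner fockNormSq
  rw [← integral_complex_ofReal]
  refine integral_congr_ae (Filter.Eventually.of_forall fun z => ?_)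
  simp only [Complex.mul_conj, Complex.normSq_eq_norm_sq]

lemma fockInner_sum_right {κ : Type*} (s : Finset κ) (p : MvPolynomial ι ℂ)
    (q : κ → MvPolynomial ι ℂ) : fockInner p (∑ i ∈ s, q i) = ∑ i ∈ s, fockInner p (q i) := by
  classical
  induction s using Finset.induction_on with
  | empty => simp [fockInner]
  | insert a s ha ih => rw [Finset.sum_insert ha, Finset.sum_insert ha, fockInner_add_right, ih]

lemma fockInner_nsmul_right (k : ℕ) (p q : MvPolynomial ι ℂ) :
    fockInner p (k • q) = k * fockInner p q := by
  have := fockInner_sum_right (Finset.range k) p (fun _ => q)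
  simpa using this

lemma conj_fockInner (p q : MvPolynomial ι ℂ) : conj (fockInner p q) = fockInner q p := by
  unfold fockInner
  rw [← integral_conj]
  simp [mul_comm]

lemma sum_fockNormSq_pderiv {p : MvPolynomial ι ℂ} {k : ℕ} (hp : p.IsHomogeneous k) :
    ∑ i, fockNormSq (pderiv i p) = k * fockNormSq p := by
  have h : (∑ i, (fockNormSq (pderiv i p) : ℂ)) = k * (fockNormSq p : ℂ) := by
    simp_rw [← fockInner_self, fockInner_pderiv]
    rw [← fockInner_sum_right, hp.sum_X_mul_pderiv, fockInner_nsmul_right]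
  exact_mod_cast h

lemma sum_fockNormSq_X_mul {p : MvPolynomial ι ℂ} {k : ℕ} (hp : p.IsHomogeneous k) :
    ∑ i, fockNormSq (X i * p) = (k + Fintype.card ι) * fockNormSq p := by
  have h : (∑ i, (fockNormSq (X i * p) : ℂ)) = (k + Fintype.card ι) * (fockNormSq p : ℂ) := by
    simp_rw [← fockInner_self, ← fockInner_pderiv, Derivation.leibniz, pderiv_X_self, smul_eq_mul,
      mul_one, fockInner_add_left]
    rw [Finset.sum_add_distrib]
    have : ∀ i, fockInner (X i * pderiv i p) p = conj (fockInner p (X i * pderiv i p)) :=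
      fun i => (conj_fockInner _ _).symm
    simp_rw [this]
    rw [← map_sum, ← fockInner_sum_right, hp.sum_X_mul_pderiv, fockInner_nsmul_right, map_mul,
      conj_fockInner]
    simp
    ring
  exact_mod_cast h

/-- The squared euclidean norm on `ℂ^ι`. -/
def euclSq (z : ι → ℂ) : ℝ := ∑ i, ‖z i‖ ^ 2

lemma euclSq_nonneg (z : ι → ℂ) : 0 ≤ euclSq z := Finset.sum_nonneg fun _ _ => by positivity

lemma continuous_euclSq : Continuous (euclSq : (ι → ℂ) → ℝ) := by
  unfold euclSq; fun_prop

lemma euclSq_mul_norm_sq (p : MvPolynomial ι ℂ) (z : ι → ℂ) :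
    euclSq z * ‖eval z p‖ ^ 2 = ∑ i, ‖eval z (X i * p)‖ ^ 2 := by
  simp [euclSq, Finset.sum_mul, mul_pow]

lemma integrable_euclSq_mul (p : MvPolynomial ι ℂ) :
    Integrable (fun z => euclSq z * ‖eval z p‖ ^ 2) (gaussPi ι) := by
  simp_rw [euclSq_mul_norm_sq]
  exact integrable_finsetSum _ fun i _ => integrable_norm_sq_eval _

lemma integral_euclSq_mul {p : MvPolynomial ι ℂ} {k : ℕ} (hp : p.IsHomogeneous k) :
    ∫ z, euclSq z * ‖eval z p‖ ^ 2 ∂gaussPi ι = (k + Fintype.card ι) * fockNormSq p := by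
  simp_rw [euclSq_mul_norm_sq]
  rw [integral_finsetSum _ fun i _ => integrable_norm_sq_eval _]
  exact sum_fockNormSq_X_mul hp

lemma euclSq_sq_mul_norm_sq (p : MvPolynomial ι ℂ) (z : ι → ℂ) :
    euclSq z ^ 2 * ‖eval z p‖ ^ 2 = ∑ i, euclSq z * ‖eval z (X i * p)‖ ^ 2 := by
  rw [← Finset.mul_sum, ← euclSq_mul_norm_sq]; ring

lemma integrable_euclSq_sq_mul (p : MvPolynomial ι ℂ) :
    Integrable (fun z => euclSq z ^ 2 * ‖eval z p‖ ^ 2) (gaussPi ι) := by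
  simp_rw [euclSq_sq_mul_norm_sq]
  exact integrable_finsetSum _ fun i _ => integrable_euclSq_mul _

lemma integral_euclSq_sq_mul {p : MvPolynomial ι ℂ} {k : ℕ} (hp : p.IsHomogeneous k) :
    ∫ z, euclSq z ^ 2 * ‖eval z p‖ ^ 2 ∂gaussPi ι =
      (k + Fintype.card ι + 1) * ((k + Fintype.card ι) * fockNormSq p) := by
  simp_rw [euclSq_sq_mul_norm_sq]
  rw [integral_finsetSum _ fun i _ => integrable_euclSq_mul _]
  have : ∀ i, ∫ z, euclSq z * ‖eval z (X i * p)‖ ^ 2 ∂gaussPi ι =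
      (k + Fintype.card ι + 1) * fockNormSq (X i * p) := by
    intro i
    have h := integral_euclSq_mul ((isHomogeneous_X ℂ i).mul hp)
    rw [h]; push_cast; ring
  simp_rw [this]
  rw [← Finset.mul_sum, sum_fockNormSq_X_mul hp]

/-- Multiplication by the euclidean norm is, on homogeneous polynomials of large degree, nearly
a scalar. -/
lemma integral_norm_sub_le {p : MvPolynomial ι ℂ} {k : ℕ} (hp : p.IsHomogeneous k)
    (hm : 0 < k + Fintype.card ι) :
    Integrable (fun z => (1 - euclSq z / (k + Fintype.card ι)) ^ 2 * ‖eval z p‖ ^ 2) (gaussPi ι) ∧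
    ∫ z, (1 - euclSq z / (k + Fintype.card ι)) ^ 2 * ‖eval z p‖ ^ 2 ∂gaussPi ι =
      1 / (k + Fintype.card ι) * fockNormSq p := by
  have hm' : ((k : ℝ) + Fintype.card ι) ≠ 0 := by exact_mod_cast hm.ne'
  have e : ∀ z : ι → ℂ, (1 - euclSq z / (k + Fintype.card ι)) ^ 2 * ‖eval z p‖ ^ 2 =
      ‖eval z p‖ ^ 2 - 2 / (k + Fintype.card ι) * (euclSq z * ‖eval z p‖ ^ 2) +
        1 / (k + Fintype.card ι) ^ 2 * (euclSq z ^ 2 * ‖eval z p‖ ^ 2) := by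
    intro z
    generalize (k : ℝ) + Fintype.card ι = m at hm'
    field_simp
    ring
  simp_rw [e]
  have i1 := integrable_norm_sq_eval p
  have i2 := (integrable_euclSq_mul p).const_mul (2 / ((k : ℝ) + Fintype.card ι))
  have i3 := (integrable_euclSq_sq_mul p).const_mul (1 / ((k : ℝ) + Fintype.card ι) ^ 2)
  have i12 : Integrable (fun z => ‖eval z p‖ ^ 2 -
      2 / (k + Fintype.card ι) * (euclSq z * ‖eval z p‖ ^ 2)) (gaussPi ι) := i1.sub i2
  refine ⟨i12.add i3, ?_⟩
  rw [integral_add i12 i3, integral_sub i1 i2, integral_const_mul, integral_const_mul,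
    integral_euclSq_mul hp, integral_euclSq_sq_mul hp]
  change fockNormSq p - _ + _ = _
  field_simp
  ring

/-- Multiplication by `conj z i` on homogeneous polynomials is close to the derivative. -/
lemma integral_conj_mul_sub_pderiv_le {p : MvPolynomial ι ℂ} {k : ℕ} (hp : p.IsHomogeneous k)
    (i : ι) :
    Integrable (fun z => ‖conj (z i) * eval z p - eval z (pderiv i p)‖ ^ 2) (gaussPi ι) ∧
    ∫ z, ‖conj (z i) * eval z p - eval z (pderiv i p)‖ ^ 2 ∂gaussPi ι ≤
      Fintype.card ι * fockNormSq p := by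
  have e : ∀ z : ι → ℂ, ∑ j, ‖conj (z j) * eval z p - eval z (pderiv j p)‖ ^ 2 =
      euclSq z * ‖eval z p‖ ^ 2 - 2 * k * ‖eval z p‖ ^ 2 + ∑ j, ‖eval z (pderiv j p)‖ ^ 2 := by
    intro z
    have he : ∑ j, z j * eval z (pderiv j p) = k * eval z p := by
      have := congrArg (eval z) hp.sum_X_mul_pderiv
      simpa using this
    have h1 : ∀ a b c : ℂ, ‖conj a * b - c‖ ^ 2 =
        ‖a‖ ^ 2 * ‖b‖ ^ 2 - 2 * (conj b * (a * c)).re + ‖c‖ ^ 2 := by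
      intro a b c
      simp only [← Complex.normSq_eq_norm_sq, Complex.normSq_apply, Complex.sub_re, Complex.sub_im,
        Complex.mul_re, Complex.mul_im, Complex.conj_re, Complex.conj_im]
      ring
    simp_rw [h1]
    rw [Finset.sum_add_distrib, Finset.sum_sub_distrib, ← Finset.mul_sum, ← Complex.re_sum,
      ← Finset.mul_sum, he, euclSq, Finset.sum_mul]
    congr 2
    have : conj (eval z p) * (k * eval z p) = ((k * ‖eval z p‖ ^ 2 : ℝ) : ℂ) := by
      rw [mul_left_comm, mul_comm (conj _), Complex.mul_conj, Complex.normSq_eq_norm_sq]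
      push_cast; rfl
    rw [this, Complex.ofReal_re]
    ring
  have hi : ∀ z : ι → ℂ, ‖conj (z i) * eval z p - eval z (pderiv i p)‖ ^ 2 ≤
      euclSq z * ‖eval z p‖ ^ 2 - 2 * k * ‖eval z p‖ ^ 2 + ∑ j, ‖eval z (pderiv j p)‖ ^ 2 := by
    intro z
    rw [← e]
    exact Finset.single_le_sum (f := fun j => ‖conj (z j) * eval z p - eval z (pderiv j p)‖ ^ 2)
      (fun _ _ => by positivity) (Finset.mem_univ i)
  have i1 := integrable_euclSq_mul p
  have i2 := (integrable_norm_sq_eval p).const_mul (2 * (k : ℝ))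
  have i3 : Integrable (fun z => ∑ j, ‖eval z (pderiv j p)‖ ^ 2) (gaussPi ι) :=
    integrable_finsetSum _ fun j _ => integrable_norm_sq_eval _
  have i12 : Integrable (fun z => euclSq z * ‖eval z p‖ ^ 2 - 2 * k * ‖eval z p‖ ^ 2)
      (gaussPi ι) := i1.sub i2
  have int : Integrable (fun z => ‖conj (z i) * eval z p - eval z (pderiv i p)‖ ^ 2)
      (gaussPi ι) := by
    refine (i12.add i3).mono' ?_ (Filter.Eventually.of_forall fun z => ?_)
    · have := MvPolynomial.continuous_eval p
      have := MvPolynomial.continuous_eval (pderiv i p)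
      exact (by fun_prop : Continuous fun z : ι → ℂ =>
        ‖conj (z i) * eval z p - eval z (pderiv i p)‖ ^ 2).aestronglyMeasurable
    · rw [Real.norm_of_nonneg (by positivity)]
      exact hi z
  refine ⟨int, (integral_mono int (i12.add i3) hi).trans (le_of_eq ?_)⟩
  simp only [Pi.add_apply]
  rw [integral_add i12 i3, integral_sub i1 i2,
    integral_finsetSum _ fun j _ => integrable_norm_sq_eval _, integral_euclSq_mul hp,
    integral_const_mul]
  change _ - 2 * k * fockNormSq p + ∑ j, fockNormSq (pderiv j p) = _
  rw [sum_fockNormSq_pderiv hp]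
  ring

end Fock

section Toeplitz
open MeasureTheory ComplexConjugate MvPolynomial Filter
open scoped NNReal ENNReal

variable {ι : Type} [Fintype ι]

/-- The `L²` norm with respect to the Gaussian measure. -/
def gaussNorm (F : (ι → ℂ) → ℂ) : ℝ≥0∞ := eLpNorm F 2 (gaussPi ι)

lemma gaussNorm_add_le {F G : (ι → ℂ) → ℂ} (hF : Measurable F) (hG : Measurable G) :
    gaussNorm (fun z => F z + G z) ≤ gaussNorm F + gaussNorm G :=
  eLpNorm_add_le hF.aestronglyMeasurable hG.aestronglyMeasurable (by norm_num)

lemma gaussNorm_le_mul {F G : (ι → ℂ) → ℂ} {c : ℝ≥0} (h : ∀ z, ‖F z‖₊ ≤ c * ‖G z‖₊) :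
    gaussNorm F ≤ c * gaussNorm G :=
  eLpNorm_le_nnreal_smul_eLpNorm_of_ae_le_mul (Eventually.of_forall h) 2

lemma measurable_eval_polynomial (p : MvPolynomial ι ℂ) : Measurable fun z => eval z p :=
  (MvPolynomial.continuous_eval p).measurable

lemma gaussNorm_eq {F : (ι → ℂ) → ℂ} (hF : Measurable F)
    (hi : Integrable (fun z => ‖F z‖ ^ 2) (gaussPi ι)) :
    gaussNorm F = ENNReal.ofReal (Real.sqrt (∫ z, ‖F z‖ ^ 2 ∂gaussPi ι)) := by
  have hm : MemLp F 2 (gaussPi ι) :=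
    (memLp_two_iff_integrable_sq_norm hF.aestronglyMeasurable).2 hi
  unfold gaussNorm
  rw [hm.eLpNorm_eq_integral_rpow_norm (by norm_num) (by norm_num), Real.sqrt_eq_rpow]
  simp

lemma gaussNorm_eval (p : MvPolynomial ι ℂ) :
    gaussNorm (fun z => eval z p) = ENNReal.ofReal (Real.sqrt (fockNormSq p)) :=
  gaussNorm_eq (measurable_eval_polynomial p) (integrable_norm_sq_eval p)

lemma gaussNorm_le_of_integral_le {F : (ι → ℂ) → ℂ} {p : MvPolynomial ι ℂ} {c : ℝ≥0}
    (hF : Measurable F) (hi : Integrable (fun z => ‖F z‖ ^ 2) (gaussPi ι))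
    (h : ∫ z, ‖F z‖ ^ 2 ∂gaussPi ι ≤ c ^ 2 * fockNormSq p) :
    gaussNorm F ≤ c * gaussNorm fun z => eval z p := by
  rw [gaussNorm_eq hF hi, gaussNorm_eval, ← ENNReal.ofReal_coe_nnreal,
    ← ENNReal.ofReal_mul (NNReal.coe_nonneg c)]
  apply ENNReal.ofReal_le_ofReal
  refine (Real.sqrt_le_sqrt h).trans (le_of_eq ?_)
  rw [Real.sqrt_mul (by positivity), Real.sqrt_sq (NNReal.coe_nonneg c)]

/-- A bounded function `φ` of weight `m` under the circle action such that the products of `φ`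
with homogeneous polynomials of large degree are nearly homogeneous polynomials. -/
structure NearlyHolomorphic (m : ℤ) (φ : (ι → ℂ) → ℂ) : Prop where
  measurable : Measurable φ
  bounded : ∃ C : ℝ≥0, ∀ z, ‖φ z‖₊ ≤ C
  weight : ∀ (c : ℂ) (z : ι → ℂ), ‖c‖ = 1 → φ (c • z) = c ^ m * φ z
  approx : ∀ ε : ℝ≥0, 0 < ε → ∃ K : ℕ, ∀ k ≥ K, ∀ l : ℕ, (l : ℤ) = k + m →
    ∀ p : MvPolynomial ι ℂ, p.IsHomogeneous k → ∃ q : MvPolynomial ι ℂ, q.IsHomogeneous l ∧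
      gaussNorm (fun z => φ z * eval z p - eval z q) ≤ ε * gaussNorm fun z => eval z p

namespace NearlyHolomorphic

lemma mul {m n : ℤ} {φ ψ : (ι → ℂ) → ℂ} (hφ : NearlyHolomorphic m φ)
    (hψ : NearlyHolomorphic n ψ) : NearlyHolomorphic (m + n) fun z => φ z * ψ z := by
  obtain ⟨C, hC⟩ := hφ.bounded
  obtain ⟨D, hD⟩ := hψ.bounded
  refine ⟨hφ.measurable.mul hψ.measurable, ⟨C * D, fun z => ?_⟩, fun c z hc => ?_, fun ε hε => ?_⟩
  · rw [nnnorm_mul]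
    exact mul_le_mul' (hC z) (hD z)
  · have hc0 : c ≠ 0 := by rintro rfl; simp at hc
    rw [hφ.weight c z hc, hψ.weight c z hc, zpow_add₀ hc0]
    ring
  · set a : ℝ≥0 := ε / (2 * (C + 1)) with ha
    have ha0 : 0 < a := by positivity
    set b : ℝ≥0 := ε / (2 * (D + a)) with hb
    have hb0 : 0 < b := by positivity
    obtain ⟨K, hK⟩ := hψ.approx a ha0
    obtain ⟨L, hL⟩ := hφ.approx b hb0
    refine ⟨K + L + n.natAbs, fun k hk l hl p hp => ?_⟩
    obtain ⟨k', hk'⟩ : ∃ k' : ℕ, (k' : ℤ) = k + n := ⟨(k + n).toNat, by omega⟩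
    obtain ⟨q, hq, hpq⟩ := hK k (by omega) k' hk' p hp
    obtain ⟨r, hr, hqr⟩ := hL k' (by omega) l (by omega) q hq
    refine ⟨r, hr, ?_⟩
    have m1 := measurable_eval_polynomial p
    have m2 := measurable_eval_polynomial q
    have m3 := measurable_eval_polynomial r
    have m4 := hφ.measurable
    have m5 := hψ.measurable
    have hqn : gaussNorm (fun z => eval z q) ≤ (D + a) * gaussNorm fun z => eval z p := by
      have e : (fun z => eval z q) =
          fun z => ψ z * eval z p + (-(ψ z * eval z p - eval z q)) := by
        ext z; ring
      rw [e]
      refine (gaussNorm_add_le (by fun_prop) (by fun_prop)).trans ?_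
      rw [add_mul]
      refine add_le_add (gaussNorm_le_mul fun z => ?_) (le_trans (le_of_eq ?_) hpq)
      · rw [nnnorm_mul]
        exact mul_le_mul' (hD z) le_rfl
      · exact eLpNorm_neg (fun z => ψ z * eval z p - eval z q) 2 (gaussPi ι)
    have e : (fun z => φ z * ψ z * eval z p - eval z r) =
        fun z => φ z * (ψ z * eval z p - eval z q) + (φ z * eval z q - eval z r) := by
      ext z; ring
    rw [e]
    refine (gaussNorm_add_le (by fun_prop) (by fun_prop)).trans ?_
    have h1 : gaussNorm (fun z => φ z * (ψ z * eval z p - eval z q)) ≤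
        C * gaussNorm fun z => ψ z * eval z p - eval z q := by
      refine gaussNorm_le_mul fun z => ?_
      rw [nnnorm_mul]
      exact mul_le_mul' (hC z) le_rfl
    calc _ ≤ (C : ℝ≥0∞) * (a * gaussNorm fun z => eval z p) +
          b * ((D + a) * gaussNorm fun z => eval z p) :=
          add_le_add (h1.trans (mul_le_mul_right hpq _)) (hqr.trans (mul_le_mul_right hqn _))
      _ = ((C * a + b * (D + a) : ℝ≥0) : ℝ≥0∞) * gaussNorm fun z => eval z p := by
          push_cast; ring
      _ ≤ _ := by
          refine mul_le_mul_left ?_ _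
          rw [ENNReal.coe_le_coe]
          have e1 : C * a ≤ ε / 2 := by
            have : (C + 1) * a = ε / 2 := by rw [ha]; field_simp
            rw [← this]
            exact mul_le_mul_left (by simp) _
          have e2 : b * (D + a) = ε / 2 := by
            rw [hb]
            have : D + a ≠ 0 := by positivity
            field_simp
          rw [e2]
          calc C * a + ε / 2 ≤ ε / 2 + ε / 2 := by gcongr
            _ = ε := add_halves ε

lemma add {m : ℤ} {φ ψ : (ι → ℂ) → ℂ} (hφ : NearlyHolomorphic m φ)
    (hψ : NearlyHolomorphic m ψ) : NearlyHolomorphic m fun z => φ z + ψ z := by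
  obtain ⟨C, hC⟩ := hφ.bounded
  obtain ⟨D, hD⟩ := hψ.bounded
  refine ⟨hφ.measurable.add hψ.measurable, ⟨C + D, fun z => ?_⟩, fun c z hc => ?_, fun ε hε => ?_⟩
  · exact (nnnorm_add_le _ _).trans (add_le_add (hC z) (hD z))
  · rw [hφ.weight c z hc, hψ.weight c z hc]
    ring
  · obtain ⟨K, hK⟩ := hφ.approx (ε / 2) (by positivity)
    obtain ⟨L, hL⟩ := hψ.approx (ε / 2) (by positivity)
    refine ⟨K + L, fun k hk l hl p hp => ?_⟩
    obtain ⟨q, hq, hpq⟩ := hK k (by omega) l hl p hp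
    obtain ⟨r, hr, hpr⟩ := hL k (by omega) l hl p hp
    refine ⟨q + r, hq.add hr, ?_⟩
    have m1 := measurable_eval_polynomial p
    have m2 := measurable_eval_polynomial q
    have m3 := measurable_eval_polynomial r
    have m4 := hφ.measurable
    have m5 := hψ.measurable
    have e : (fun z => (φ z + ψ z) * eval z p - eval z (q + r)) =
        fun z => (φ z * eval z p - eval z q) + (ψ z * eval z p - eval z r) := by
      ext z; rw [map_add]; ring
    rw [e]
    refine (gaussNorm_add_le (by fun_prop) (by fun_prop)).trans
      ((add_le_add hpq hpr).trans (le_of_eq ?_))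
    rw [← add_mul, ← ENNReal.coe_add, add_halves]

lemma const_mul {m : ℤ} {φ : (ι → ℂ) → ℂ} (hφ : NearlyHolomorphic m φ) (a : ℂ) :
    NearlyHolomorphic m fun z => a * φ z := by
  obtain ⟨C, hC⟩ := hφ.bounded
  refine ⟨hφ.measurable.const_mul a, ⟨‖a‖₊ * C, fun z => ?_⟩, fun c z hc => ?_, fun ε hε => ?_⟩
  · rw [nnnorm_mul]
    exact mul_le_mul' le_rfl (hC z)
  · rw [hφ.weight c z hc]
    ring
  · obtain ⟨K, hK⟩ := hφ.approx (ε / (‖a‖₊ + 1)) (by positivity)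
    refine ⟨K, fun k hk l hl p hp => ?_⟩
    obtain ⟨q, hq, hpq⟩ := hK k hk l hl p hp
    refine ⟨MvPolynomial.C a * q, by simpa using (isHomogeneous_C ι a).mul hq, ?_⟩
    have e : (fun z => a * φ z * eval z p - eval z (MvPolynomial.C a * q)) =
        fun z => a * (φ z * eval z p - eval z q) := by
      ext z; rw [map_mul, eval_C]; ring
    rw [e]
    have h1 : gaussNorm (fun z => a * (φ z * eval z p - eval z q)) ≤
        ‖a‖₊ * gaussNorm fun z => φ z * eval z p - eval z q :=
      gaussNorm_le_mul fun z => le_of_eq (nnnorm_mul _ _)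
    refine h1.trans ((mul_le_mul_right hpq _).trans ?_)
    rw [← mul_assoc]
    refine mul_le_mul_left ?_ _
    rw [← ENNReal.coe_mul, ENNReal.coe_le_coe]
    calc ‖a‖₊ * (ε / (‖a‖₊ + 1)) ≤ (‖a‖₊ + 1) * (ε / (‖a‖₊ + 1)) := by gcongr; simp
      _ = ε := by field_simp

lemma zero (m : ℤ) : NearlyHolomorphic m fun _ : ι → ℂ => 0 := by
  refine ⟨measurable_const, ⟨0, by simp⟩, by simp, fun ε _ => ⟨0, fun k _ l _ p _ => ⟨0, ?_, ?_⟩⟩⟩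
  · exact isHomogeneous_zero ι ℂ l
  · simp [gaussNorm]

lemma of_uniform_approx {m : ℤ} {φ : (ι → ℂ) → ℂ} (hm : Measurable φ)
    (hw : ∀ (c : ℂ) (z : ι → ℂ), ‖c‖ = 1 → φ (c • z) = c ^ m * φ z)
    (h : ∀ ε : ℝ≥0, 0 < ε → ∃ ψ, NearlyHolomorphic m ψ ∧ ∀ z, ‖φ z - ψ z‖₊ ≤ ε) :
    NearlyHolomorphic m φ := by
  refine ⟨hm, ?_, hw, fun ε hε => ?_⟩
  · obtain ⟨ψ, hψ, h1⟩ := h 1 one_pos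
    obtain ⟨C, hC⟩ := hψ.bounded
    refine ⟨1 + C, fun z => ?_⟩
    calc ‖φ z‖₊ = ‖(φ z - ψ z) + ψ z‖₊ := by rw [sub_add_cancel]
      _ ≤ _ := (nnnorm_add_le _ _).trans (add_le_add (h1 z) (hC z))
  · obtain ⟨ψ, hψ, h1⟩ := h (ε / 2) (by positivity)
    obtain ⟨K, hK⟩ := hψ.approx (ε / 2) (by positivity)
    refine ⟨K, fun k hk l hl p hp => ?_⟩
    obtain ⟨q, hq, hpq⟩ := hK k hk l hl p hp
    refine ⟨q, hq, ?_⟩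
    have m1 := measurable_eval_polynomial p
    have m2 := measurable_eval_polynomial q
    have m4 := hψ.measurable
    have e : (fun z => φ z * eval z p - eval z q) =
        fun z => (φ z - ψ z) * eval z p + (ψ z * eval z p - eval z q) := by
      ext z; ring
    rw [e]
    refine (gaussNorm_add_le (by fun_prop) (by fun_prop)).trans ?_
    have h2 : gaussNorm (fun z => (φ z - ψ z) * eval z p) ≤
        (ε / 2 : ℝ≥0) * gaussNorm fun z => eval z p := by
      refine gaussNorm_le_mul fun z => ?_
      rw [nnnorm_mul]
      exact mul_le_mul' (h1 z) le_rfl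
    refine (add_le_add h2 hpq).trans (le_of_eq ?_)
    rw [← add_mul, ← ENNReal.coe_add, add_halves]

end NearlyHolomorphic

omit [Fintype ι] in
/-- The degree `m` part of a uniform approximation is at least as good an approximation. -/
lemma norm_le_of_norm_add_sum_le {m : ℤ} {χ : (ι → ℂ) → ℂ} {ψ : ℤ → (ι → ℂ) → ℂ} {ε : ℝ}
    (hχ : ∀ (c : ℂ) (z : ι → ℂ), ‖c‖ = 1 → χ (c • z) = c ^ m * χ z)
    (hψ : ∀ (n : ℤ) (c : ℂ) (z : ι → ℂ), ‖c‖ = 1 → ψ n (c • z) = c ^ n * ψ n z)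
    (W : Finset ℤ) (hW : m ∉ W) (h : ∀ z, ‖χ z + ∑ n ∈ W, ψ n z‖ ≤ ε) (z : ι → ℂ) :
    ‖χ z‖ ≤ ε := by
  induction W using Finset.induction_on generalizing ψ with
  | empty => simpa using h z
  | insert w W hw ih =>
    have hwm : w - m ≠ 0 := by
      rintro h0
      exact hW (by rw [← sub_eq_zero.1 h0]; exact Finset.mem_insert_self _ _)
    obtain ⟨c, hc, hcw⟩ : ∃ c : ℂ, ‖c‖ = 1 ∧ c ^ (w - m) = -1 := by
      refine ⟨Complex.exp ((Real.pi / ((w - m : ℤ) : ℝ) : ℝ) * Complex.I),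
        Complex.norm_exp_ofReal_mul_I _, ?_⟩
      have : ((w - m : ℤ) : ℂ) ≠ 0 := by exact_mod_cast hwm
      rw [← Complex.exp_int_mul, ← Complex.exp_pi_mul_I]
      congr 1
      rw [Complex.ofReal_div, Complex.ofReal_intCast]
      field_simp
    have hc0 : c ≠ 0 := by rintro rfl; simp at hc
    refine ih (ψ := fun n z => (1 + c ^ (n - m)) / 2 * ψ n z) (fun n d z hd => ?_)
      (fun hm => hW (Finset.mem_insert_of_mem hm)) (fun z => ?_)
    · rw [hψ n d z hd]; ring
    · have h1 := h z
      have h2 := h (c • z)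
      rw [Finset.sum_insert hw] at h1 h2
      have e : χ z + ∑ n ∈ W, (1 + c ^ (n - m)) / 2 * ψ n z =
          ((χ z + (ψ w z + ∑ n ∈ W, ψ n z)) +
            c ^ (-m) * (χ (c • z) + (ψ w (c • z) + ∑ n ∈ W, ψ n (c • z)))) / 2 := by
        simp_rw [hψ _ c z hc, hχ c z hc]
        simp only [mul_add, Finset.mul_sum, ← mul_assoc, ← zpow_add₀ hc0, neg_add_cancel,
          zpow_zero, neg_add_eq_sub, hcw]
        have : ∀ n, (1 + c ^ (n - m)) / 2 * ψ n z = (ψ n z + c ^ (n - m) * ψ n z) / 2 := by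
          intro n; ring
        simp_rw [this, ← Finset.sum_div, Finset.sum_add_distrib]
        ring
      rw [e, norm_div]
      have h3 : ‖c ^ (-m) * (χ (c • z) + (ψ w (c • z) + ∑ n ∈ W, ψ n (c • z)))‖ ≤ ε := by
        rw [norm_mul, norm_zpow, hc, one_zpow, one_mul]
        exact h2
      have h4 := norm_add_le (χ z + (ψ w z + ∑ n ∈ W, ψ n z))
        (c ^ (-m) * (χ (c • z) + (ψ w (c • z) + ∑ n ∈ W, ψ n (c • z))))
      rw [Complex.norm_ofNat, div_le_iff₀ (by norm_num)]
      linarith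

end Toeplitz

section Generators
open MeasureTheory ComplexConjugate MvPolynomial Filter
open scoped NNReal ENNReal

variable {ι : Type} [Fintype ι]

lemma euclSq_smul (c : ℂ) (z : ι → ℂ) : euclSq (c • z) = ‖c‖ ^ 2 * euclSq z := by
  simp [euclSq, mul_pow, Finset.mul_sum]

lemma norm_sq_le_euclSq (z : ι → ℂ) (i : ι) : ‖z i‖ ^ 2 ≤ euclSq z :=
  Finset.single_le_sum (f := fun i => ‖z i‖ ^ 2) (fun _ _ => by positivity) (Finset.mem_univ i)

lemma norm_le_sqrt_euclSq (z : ι → ℂ) (i : ι) : ‖z i‖ ≤ √(euclSq z) :=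
  Real.le_sqrt_of_sq_le (norm_sq_le_euclSq z i)

lemma inv_sqrt_sub_sq_mul_le {s t m : ℝ} (hts : t ≤ s) (ht : 0 ≤ t) (hm : 0 < m) :
    ((√s)⁻¹ - (√m)⁻¹) ^ 2 * t ≤ (1 - s / m) ^ 2 := by
  rcases (ht.trans hts).eq_or_lt with h | h
  · have : t = 0 := le_antisymm (h ▸ hts) ht
    rw [this, mul_zero]; positivity
  · have hs' : 0 < √s := Real.sqrt_pos.2 h
    have hm' : 0 < √m := Real.sqrt_pos.2 hm
    have es : √s ^ 2 = s := Real.sq_sqrt h.le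
    have em : √m ^ 2 = m := Real.sq_sqrt hm.le
    calc ((√s)⁻¹ - (√m)⁻¹) ^ 2 * t ≤ ((√s)⁻¹ - (√m)⁻¹) ^ 2 * √s ^ 2 := by
          rw [es]; gcongr
      _ = (1 - √s / √m) ^ 2 := by field_simp
      _ ≤ (1 - √s / √m) ^ 2 * (1 + √s / √m) ^ 2 := by
          apply le_mul_of_one_le_right (by positivity)
          apply one_le_pow₀
          linarith [div_pos hs' hm']
      _ = (1 - √s ^ 2 / √m ^ 2) ^ 2 := by rw [← div_pow]; ring
      _ = _ := by rw [es, em]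

lemma gaussNorm_inv_sqrt_sub_le {p : MvPolynomial ι ℂ} {k : ℕ} (hp : p.IsHomogeneous k)
    (hm : 0 < k + Fintype.card ι) {w : (ι → ℂ) → ℂ} (hw : Measurable w)
    (i : ι) (hwi : ∀ z, ‖w z‖ = ‖z i‖) :
    gaussNorm (fun z => (((√(euclSq z))⁻¹ - (√((k + Fintype.card ι : ℕ) : ℝ))⁻¹ : ℝ) : ℂ) *
      w z * eval z p) ≤
      NNReal.sqrt (1 / ((k + Fintype.card ι : ℕ) : ℝ≥0)) * gaussNorm fun z => eval z p := by
  have mp := measurable_eval_polynomial p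
  have ms := (continuous_euclSq (ι := ι)).measurable
  obtain ⟨h1, h2⟩ := integral_norm_sub_le hp hm
  have hm' : (0 : ℝ) < ((k + Fintype.card ι : ℕ) : ℝ) := by exact_mod_cast hm
  have hle : ∀ z, ‖(((√(euclSq z))⁻¹ - (√((k + Fintype.card ι : ℕ) : ℝ))⁻¹ : ℝ) : ℂ) *
      w z * eval z p‖ ^ 2 ≤ (1 - euclSq z / (k + Fintype.card ι)) ^ 2 * ‖eval z p‖ ^ 2 := by
    intro z
    rw [norm_mul, norm_mul, hwi, Complex.norm_real, mul_pow, mul_pow, Real.norm_eq_abs, sq_abs]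
    refine mul_le_mul_of_nonneg_right ?_ (by positivity)
    have := inv_sqrt_sub_sq_mul_le (norm_sq_le_euclSq z i) (by positivity) hm'
    push_cast at this ⊢
    exact this
  have hF : Measurable fun z => (((√(euclSq z))⁻¹ - (√((k + Fintype.card ι : ℕ) : ℝ))⁻¹ : ℝ) : ℂ) *
      w z * eval z p := by fun_prop
  have hi := h1.mono' (hF.norm.pow_const 2).aestronglyMeasurable
    (Eventually.of_forall fun z => by
      rw [Real.norm_eq_abs, abs_of_nonneg (by positivity)]; exact hle z)
  refine gaussNorm_le_of_integral_le hF hi ((integral_mono hi h1 hle).trans (le_of_eq ?_))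
  rw [h2]
  congr 1
  rw [← NNReal.coe_pow, NNReal.sq_sqrt]
  push_cast
  rfl

lemma exists_forall_sqrt_div_le (a : ℝ≥0) (n : ℕ) {ε : ℝ≥0} (hε : 0 < ε) :
    ∃ K : ℕ, ∀ k ≥ K, NNReal.sqrt (a / ((k + n : ℕ) : ℝ≥0)) ≤ ε := by
  obtain ⟨K, hK⟩ := exists_nat_ge (a / ε ^ 2)
  refine ⟨K + 1, fun k hk => ?_⟩
  rw [NNReal.sqrt_le_iff_le_sq]
  have h0 : (0 : ℝ≥0) < ((k + n : ℕ) : ℝ≥0) := by exact_mod_cast (by omega : 0 < k + n)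
  rw [div_le_iff₀ h0, mul_comm, ← div_le_iff₀ (by positivity)]
  refine hK.trans ?_
  exact_mod_cast (by omega : K ≤ k + n)

lemma nnnorm_mul_inv_sqrt_euclSq_le {w : ℂ} {z : ι → ℂ} {i : ι} (h : ‖w‖ = ‖z i‖) :
    ‖w * (((√(euclSq z))⁻¹ : ℝ) : ℂ)‖₊ ≤ 1 := by
  rw [← NNReal.coe_le_coe, coe_nnnorm, norm_mul, Complex.norm_real, h, NNReal.coe_one, norm_inv,
    Real.norm_of_nonneg (Real.sqrt_nonneg _)]
  exact mul_inv_le_one_of_le₀ (norm_le_sqrt_euclSq z i) (Real.sqrt_nonneg _)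

omit [Fintype ι] in
lemma eval_smul_of_isHomogeneous {p : MvPolynomial ι ℂ} {k : ℕ} (hp : p.IsHomogeneous k) (c : ℂ)
    (z : ι → ℂ) : eval (c • z) p = c ^ k * eval z p := by
  rw [eval_eq, eval_eq, Finset.mul_sum]
  refine Finset.sum_congr rfl fun d hd => ?_
  have h : d.degree = k := by
    rw [← hp (mem_support_iff.1 hd), Finsupp.degree_eq_weight_one]
    rfl
  rw [Finsupp.degree_apply] at h
  simp only [Pi.smul_apply, smul_eq_mul, mul_pow, Finset.prod_mul_distrib]
  rw [Finset.prod_pow_eq_pow_sum, h]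
  ring

namespace NearlyHolomorphic

lemma coord (i : ι) : NearlyHolomorphic 1 fun z : ι → ℂ => z i * (((√(euclSq z))⁻¹ : ℝ) : ℂ) := by
  have ms := (continuous_euclSq (ι := ι)).measurable
  refine ⟨by fun_prop, ⟨1, fun z => nnnorm_mul_inv_sqrt_euclSq_le (i := i) rfl⟩,
    fun c z hc => ?_, fun ε hε => ?_⟩
  · rw [euclSq_smul, hc]
    simp [mul_assoc]
  · obtain ⟨K, hK⟩ := exists_forall_sqrt_div_le 1 (Fintype.card ι) hε
    refine ⟨K + 1, fun k hk l hl p hp => ?_⟩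
    obtain rfl : l = k + 1 := by omega
    refine ⟨MvPolynomial.C (((√((k + Fintype.card ι : ℕ) : ℝ))⁻¹ : ℝ) : ℂ) * (X i * p), ?_, ?_⟩
    · have := (isHomogeneous_C ι (((√((k + Fintype.card ι : ℕ) : ℝ))⁻¹ : ℝ) : ℂ)).mul
        ((isHomogeneous_X ℂ i).mul hp)
      convert this using 1
      ring
    · have h1 := gaussNorm_inv_sqrt_sub_le hp (by omega) (measurable_pi_apply i) i fun z => rfl
      refine le_trans (le_of_eq ?_) (h1.trans (mul_le_mul_left
        (ENNReal.coe_le_coe.2 (hK k (by omega))) _))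
      congr 1
      ext z
      simp only [map_mul, eval_C, eval_X, Complex.ofReal_sub]
      ring

lemma conj_coord (i : ι) :
    NearlyHolomorphic (-1) fun z : ι → ℂ => conj (z i) * (((√(euclSq z))⁻¹ : ℝ) : ℂ) := by
  have ms := (continuous_euclSq (ι := ι)).measurable
  have mc : Measurable fun z : ι → ℂ => conj (z i) :=
    (Complex.continuous_conj.comp (continuous_apply i)).measurable
  refine ⟨by fun_prop, ⟨1, fun z => nnnorm_mul_inv_sqrt_euclSq_le (i := i) (by simp)⟩,
    fun c z hc => ?_, fun ε hε => ?_⟩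
  · rw [euclSq_smul, hc]
    simp [mul_assoc, Complex.inv_eq_conj hc]
  · obtain ⟨K, hK⟩ := exists_forall_sqrt_div_le 1 (Fintype.card ι) (ε := ε / 2) (by positivity)
    obtain ⟨L, hL⟩ := exists_forall_sqrt_div_le (Fintype.card ι) (Fintype.card ι) (ε := ε / 2)
      (by positivity)
    refine ⟨K + L + 1, fun k hk l hl p hp => ?_⟩
    obtain rfl : l = k - 1 := by omega
    set a : ℝ := (√((k + Fintype.card ι : ℕ) : ℝ))⁻¹ with ha
    refine ⟨MvPolynomial.C (a : ℂ) * pderiv i p, ?_, ?_⟩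
    · have := (isHomogeneous_C ι (a : ℂ)).mul (hp.pderiv (i := i))
      convert this using 1
      ring
    · have h1 := gaussNorm_inv_sqrt_sub_le hp (by omega) mc i fun z => by simp
      obtain ⟨h2, h3⟩ := integral_conj_mul_sub_pderiv_le hp i
      have mp := measurable_eval_polynomial p
      have md := measurable_eval_polynomial (pderiv i p)
      have mF : Measurable fun z => conj (z i) * eval z p - eval z (pderiv i p) := by fun_prop
      have h4 : gaussNorm (fun z => conj (z i) * eval z p - eval z (pderiv i p)) ≤
          NNReal.sqrt (Fintype.card ι) * gaussNorm fun z => eval z p := by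
        refine gaussNorm_le_of_integral_le mF h2 (h3.trans (le_of_eq ?_))
        rw [← NNReal.coe_pow, NNReal.sq_sqrt]
        simp
      have h5 : gaussNorm (fun z => (a : ℂ) * (conj (z i) * eval z p - eval z (pderiv i p))) ≤
          (ε / 2 : ℝ≥0) * gaussNorm fun z => eval z p := by
        have : gaussNorm (fun z => (a : ℂ) * (conj (z i) * eval z p - eval z (pderiv i p))) ≤
            (‖(a : ℂ)‖₊) * gaussNorm (fun z => conj (z i) * eval z p - eval z (pderiv i p)) :=
          gaussNorm_le_mul fun z => le_of_eq (nnnorm_mul _ _)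
        refine this.trans ((mul_le_mul_right h4 _).trans ?_)
        rw [← mul_assoc, ← ENNReal.coe_mul]
        refine mul_le_mul_left (ENNReal.coe_le_coe.2 (le_trans (le_of_eq ?_) (hL k (by omega)))) _
        rw [NNReal.sqrt_div, div_eq_inv_mul]
        congr 1
        rw [← NNReal.coe_inj, coe_nnnorm, Complex.norm_real, ha]
        simp
      have e : (fun z => conj (z i) * (((√(euclSq z))⁻¹ : ℝ) : ℂ) * eval z p -
          eval z (MvPolynomial.C (a : ℂ) * pderiv i p)) =
          fun z => (((√(euclSq z))⁻¹ - a : ℝ) : ℂ) * conj (z i) * eval z p +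
            (a : ℂ) * (conj (z i) * eval z p - eval z (pderiv i p)) := by
        ext z
        simp only [map_mul, eval_C, Complex.ofReal_sub]
        ring
      rw [e]
      refine (gaussNorm_add_le (by fun_prop) (by fun_prop)).trans ((add_le_add (h1.trans
        (mul_le_mul_left (ENNReal.coe_le_coe.2 (hK k (by omega))) _)) h5).trans (le_of_eq ?_))
      rw [← add_mul, ← ENNReal.coe_add, add_halves]

lemma indicator_ne_zero [DecidableEq (ι → ℂ)] :
    NearlyHolomorphic 0 fun z : ι → ℂ => if z = 0 then 0 else 1 := by
  refine ⟨Measurable.ite (measurableSet_singleton 0) measurable_const measurable_const,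
    ⟨1, fun z => by split_ifs <;> simp⟩, fun c z hc => ?_, fun ε hε => ⟨1, ?_⟩⟩
  · have hc0 : c ≠ 0 := by rintro rfl; simp at hc
    simp [hc0]
  · intro k hk l hl p hp
    obtain rfl : l = k := by omega
    refine ⟨p, hp, ?_⟩
    have : (fun z : ι → ℂ => (if z = 0 then 0 else 1) * eval z p - eval z p) = fun _ => 0 := by
      ext z
      split_ifs with h
      · have := eval_smul_of_isHomogeneous hp 0 z
        rw [zero_smul, zero_pow (by omega), zero_mul] at this
        rw [h, this]; simp
      · simp
    rw [this]
    simp [gaussNorm]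

end NearlyHolomorphic
end Generators

section Sphere
open MeasureTheory ComplexConjugate Filter
open scoped NNReal ENNReal

variable {ι : Type} [Fintype ι]

/-- The unit sphere of `ℂ^ι`. -/
abbrev CSphere (ι : Type) [Fintype ι] : Type := {z : ι → ℂ // euclSq z = 1}

lemma euclSq_pos {z : ι → ℂ} (hz : z ≠ 0) : 0 < euclSq z := by
  obtain ⟨i, hi⟩ := Function.ne_iff.1 hz
  exact lt_of_lt_of_le (pow_pos (norm_pos_iff.2 hi) 2) (norm_sq_le_euclSq z i)

instance : CompactSpace (CSphere ι) := by
  refine isCompact_iff_compactSpace.1 (Metric.isCompact_of_isClosed_isBounded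
    (isClosed_eq continuous_euclSq continuous_const) ?_)
  refine (Metric.isBounded_closedBall (x := (0 : ι → ℂ)) (r := 1)).subset fun z hz => ?_
  rw [mem_closedBall_zero_iff, pi_norm_le_iff_of_nonneg zero_le_one]
  intro i
  have := norm_le_sqrt_euclSq z i
  rwa [show euclSq z = 1 from hz, Real.sqrt_one] at this

/-- The radial projection to the unit sphere. -/
def toCSphere (z : ι → ℂ) (hz : z ≠ 0) : CSphere ι :=
  ⟨(((√(euclSq z))⁻¹ : ℝ) : ℂ) • z, by
    rw [euclSq_smul, Complex.norm_real, Real.norm_of_nonneg (by positivity), inv_pow,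
      Real.sq_sqrt (euclSq_nonneg z)]
    exact inv_mul_cancel₀ (euclSq_pos hz).ne'⟩

open Classical in
/-- The homogeneous extension of degree `0` of a function on the unit sphere, vanishing at `0`. -/
def radialExt (g : CSphere ι → ℂ) (z : ι → ℂ) : ℂ := if h : z ≠ 0 then g (toCSphere z h) else 0

lemma radialExt_mul (g h : CSphere ι → ℂ) :
    radialExt (g * h) = radialExt g * radialExt h := by
  ext z
  by_cases hz : z = 0 <;> simp [radialExt, hz]

lemma radialExt_add (g h : CSphere ι → ℂ) :
    radialExt (g + h) = radialExt g + radialExt h := by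
  ext z
  by_cases hz : z = 0 <;> simp [radialExt, hz]

/-- Finite sums of nearly holomorphic functions. -/
def nearlyHolomorphicSums (ι : Type) [Fintype ι] : AddSubmonoid ((ι → ℂ) → ℂ) :=
  AddSubmonoid.closure {φ | ∃ m, NearlyHolomorphic m φ}

lemma mul_mem_nearlyHolomorphicSums {φ ψ : (ι → ℂ) → ℂ} (hφ : φ ∈ nearlyHolomorphicSums ι)
    (hψ : ψ ∈ nearlyHolomorphicSums ι) : φ * ψ ∈ nearlyHolomorphicSums ι := by
  induction hφ using AddSubmonoid.closure_induction with
  | zero => rw [zero_mul]; exact zero_mem _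
  | add φ φ' _ _ h h' => rw [add_mul]; exact add_mem h h'
  | mem φ hφ =>
    induction hψ using AddSubmonoid.closure_induction with
    | zero => rw [mul_zero]; exact zero_mem _
    | add φ φ' _ _ h h' => rw [mul_add]; exact add_mem h h'
    | mem ψ hψ =>
      obtain ⟨m, hφ⟩ := hφ
      obtain ⟨n, hψ⟩ := hψ
      exact AddSubmonoid.subset_closure ⟨m + n, hφ.mul hψ⟩

lemma exists_eq_sum_of_mem_nearlyHolomorphicSums {φ : (ι → ℂ) → ℂ}
    (hφ : φ ∈ nearlyHolomorphicSums ι) :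
    ∃ (ψ : ℤ → (ι → ℂ) → ℂ) (W : Finset ℤ), (∀ n, NearlyHolomorphic n (ψ n)) ∧
      (∀ n ∉ W, ψ n = 0) ∧ φ = ∑ n ∈ W, ψ n := by
  induction hφ using AddSubmonoid.closure_induction with
  | zero => exact ⟨fun _ => 0, ∅, fun n => NearlyHolomorphic.zero n, by simp, by simp⟩
  | add φ φ' _ _ h h' =>
    obtain ⟨ψ, W, h1, h2, rfl⟩ := h
    obtain ⟨ψ', W', h1', h2', rfl⟩ := h'
    refine ⟨ψ + ψ', W ∪ W', fun n => (h1 n).add (h1' n), fun n hn => ?_, ?_⟩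
    · rw [Finset.notMem_union] at hn
      rw [Pi.add_apply, h2 n hn.1, h2' n hn.2, add_zero]
    · simp only [Pi.add_apply, Finset.sum_add_distrib]
      rw [Finset.sum_subset Finset.subset_union_left fun n _ hn => h2 n hn,
        Finset.sum_subset Finset.subset_union_right fun n _ hn => h2' n hn]
  | mem φ hφ =>
    obtain ⟨m, hφ⟩ := hφ
    refine ⟨Pi.single m φ, {m}, fun n => ?_, fun n hn => ?_, by simp⟩
    · by_cases h : n = m
      · subst h; simpa using hφ
      · rw [Pi.single_eq_of_ne h]; exact NearlyHolomorphic.zero n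
    · rw [Pi.single_eq_of_ne (by simpa using hn)]

/-- The coordinate functions on the unit sphere. -/
def sphereCoord (i : ι) : C(CSphere ι, ℂ) :=
  ⟨fun z => z.1 i, (continuous_apply i).comp continuous_subtype_val⟩

lemma radialExt_mem_nearlyHolomorphicSums {g : C(CSphere ι, ℂ)}
    (hg : g ∈ StarAlgebra.adjoin ℂ (Set.range (sphereCoord (ι := ι)))) :
    radialExt g ∈ nearlyHolomorphicSums ι := by
  classical
  rw [← StarSubalgebra.mem_toSubalgebra, StarAlgebra.adjoin_toSubalgebra] at hg
  induction hg using Algebra.adjoin_induction with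
  | mem g hg =>
    apply AddSubmonoid.subset_closure
    rcases hg with ⟨i, rfl⟩ | ⟨i, hi⟩
    · refine ⟨1, ?_⟩
      convert NearlyHolomorphic.coord i using 1
      ext z
      by_cases hz : z = 0 <;> simp [radialExt, hz, sphereCoord, toCSphere, mul_comm]
    · refine ⟨-1, ?_⟩
      rw [eq_star_iff_eq_star] at hi
      convert NearlyHolomorphic.conj_coord i using 1
      ext z
      by_cases hz : z = 0 <;> simp [radialExt, hz, hi, sphereCoord, toCSphere, mul_comm]
  | algebraMap r =>
    apply AddSubmonoid.subset_closure
    refine ⟨0, ?_⟩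
    convert! (NearlyHolomorphic.indicator_ne_zero (ι := ι)).const_mul r using 1
    ext z
    by_cases hz : z = 0 <;> simp [radialExt, hz]
  | add g h _ _ hg hh =>
    rw [ContinuousMap.coe_add, radialExt_add]
    exact add_mem hg hh
  | mul g h _ _ hg hh =>
    rw [ContinuousMap.coe_mul, radialExt_mul]
    exact mul_mem_nearlyHolomorphicSums hg hh

lemma adjoin_sphereCoord_dense (g : C(CSphere ι, ℂ)) {ε : ℝ} (hε : 0 < ε) :
    ∃ h ∈ StarAlgebra.adjoin ℂ (Set.range (sphereCoord (ι := ι))), ‖g - h‖ < ε := by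
  have key := ContinuousMap.starSubalgebra_topologicalClosure_eq_top_of_separatesPoints
    (StarAlgebra.adjoin ℂ (Set.range (sphereCoord (ι := ι)))) (by
      intro x y hxy
      obtain ⟨i, hi⟩ := Function.ne_iff.1 fun h => hxy (Subtype.ext h)
      exact ⟨_, ⟨sphereCoord i, StarAlgebra.subset_adjoin ℂ _ ⟨i, rfl⟩, rfl⟩, hi⟩)
  have hg : g ∈ closure (StarAlgebra.adjoin ℂ (Set.range (sphereCoord (ι := ι))) :
      Set C(CSphere ι, ℂ)) := by
    rw [← StarSubalgebra.topologicalClosure_coe, key]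
    trivial
  obtain ⟨h, hh, hd⟩ := Metric.mem_closure_iff.1 hg ε hε
  exact ⟨h, hh, by rwa [dist_eq_norm] at hd⟩

/-- Continuous functions on the punctured space that are homogeneous of degree `0` under real
scaling and of weight `m` under the circle are nearly holomorphic. -/
theorem NearlyHolomorphic.of_continuousOn {m : ℤ} {φ : (ι → ℂ) → ℂ} (h0 : φ 0 = 0)
    (hc : ContinuousOn φ {0}ᶜ) (hr : ∀ (t : ℝ) (z : ι → ℂ), 0 < t → φ ((t : ℂ) • z) = φ z)
    (hw : ∀ (c : ℂ) (z : ι → ℂ), ‖c‖ = 1 → φ (c • z) = c ^ m * φ z) : NearlyHolomorphic m φ := by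
  refine .of_uniform_approx (measurable_of_continuousOn_compl_singleton 0 hc) hw fun ε hε => ?_
  let g : C(CSphere ι, ℂ) := ⟨fun z => φ z.1, hc.comp_continuous continuous_subtype_val
    fun z hz => by
      have := z.2
      rw [Set.mem_singleton_iff.1 hz] at this
      simp [euclSq] at this⟩
  have hgφ : radialExt g = φ := by
    ext z
    by_cases hz : z = 0
    · simp [radialExt, hz, h0]
    · simp only [radialExt, ne_eq, hz, not_false_eq_true, dite_true, toCSphere, g,
        ContinuousMap.coe_mk]
      exact hr _ _ (inv_pos.2 (Real.sqrt_pos.2 (euclSq_pos hz)))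
  obtain ⟨h, hh, hgh⟩ := adjoin_sphereCoord_dense g (NNReal.coe_pos.2 hε)
  obtain ⟨ψ, W, h1, h2, h3⟩ :=
    exists_eq_sum_of_mem_nearlyHolomorphicSums (radialExt_mem_nearlyHolomorphicSums hh)
  have hd : ∀ z, ‖φ z - radialExt h z‖ ≤ ε := by
    intro z
    rw [← hgφ]
    by_cases hz : z = 0
    · simp [radialExt, hz]
    · simp only [radialExt, ne_eq, hz, not_false_eq_true, dite_true]
      exact ((g - h).norm_coe_le_norm _).trans hgh.le
  refine ⟨ψ m, h1 m, fun z => ?_⟩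
  rw [← NNReal.coe_le_coe, coe_nnnorm]
  refine norm_le_of_norm_add_sum_le (m := m) (χ := fun z => φ z - ψ m z) (ψ := fun n z => - ψ n z)
    (fun c z hc => ?_) (fun n c z hc => ?_) (W.erase m) (Finset.notMem_erase _ _) (fun z => ?_) z
  · rw [hw c z hc, (h1 m).weight c z hc]; ring
  · rw [(h1 n).weight c z hc]; ring
  · convert hd z using 2
    rw [h3, Finset.sum_apply, Finset.sum_neg_distrib]
    by_cases hm : m ∈ W
    · rw [← Finset.add_sum_erase _ _ hm]; ring
    · rw [Finset.erase_eq_of_notMem hm, h2 m hm]; simp [sub_eq_add_neg]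

end Sphere

section SkewForm
open MeasureTheory ComplexConjugate MvPolynomial Filter
open scoped NNReal ENNReal

/-- The action of the quaternion `j` on `ℂ⁶`. -/
def quatJ (z : Fin 3 × Fin 2 → ℂ) : Fin 3 × Fin 2 → ℂ :=
  fun i => if i.2 = 0 then -conj (z (i.1, 1)) else conj (z (i.1, 0))

lemma quatJ_quatJ (z : Fin 3 × Fin 2 → ℂ) : quatJ (quatJ z) = -z := by
  ext ⟨a, b⟩
  fin_cases b <;> simp [quatJ]

lemma quatJ_measurePreserving :
    MeasurePreserving quatJ (gaussPi (Fin 3 × Fin 2)) (gaussPi (Fin 3 × Fin 2)) := by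
  unfold gaussPi
  let e : Fin 3 × Fin 2 ≃ Fin 3 × Fin 2 := (Equiv.refl _).prodCongr (Equiv.swap 0 1)
  have h1 := measurePreserving_piCongrLeft (α := fun _ : Fin 3 × Fin 2 => ℂ) (fun _ => gaussC) e
  have h2 := measurePreserving_pi (fun _ : Fin 3 × Fin 2 => gaussC) (fun _ => gaussC)
    (f := fun i => ⇑(if i.2 = 0 then Complex.conjLIE.trans (LinearIsometryEquiv.neg ℝ)
      else Complex.conjLIE : ℂ ≃ₗᵢ[ℝ] ℂ))
    fun i => gaussC_measurePreserving_linearIsometryEquiv _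
  convert h2.comp h1 using 1
  ext z ⟨a, b⟩
  have : ∀ i, (MeasurableEquiv.piCongrLeft (fun _ : Fin 3 × Fin 2 => ℂ) e) z i = z (e.symm i) := by
    intro i
    obtain ⟨j, rfl⟩ := e.surjective i
    rw [MeasurableEquiv.coe_piCongrLeft, Equiv.piCongrLeft_apply_apply, e.symm_apply_apply]
  fin_cases b <;> simp [quatJ, this, e]

/-- The antilinear action of the quaternion `j` on polynomials. -/
def polyJ (p : MvPolynomial (Fin 3 × Fin 2) ℂ) : MvPolynomial (Fin 3 × Fin 2) ℂ :=
  aeval (fun i : Fin 3 × Fin 2 => if i.2 = 0 then -X (i.1, 1) else X (i.1, 0))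
    (MvPolynomial.map (starRingEnd ℂ) p)

lemma eval_polyJ (p : MvPolynomial (Fin 3 × Fin 2) ℂ) (z : Fin 3 × Fin 2 → ℂ) :
    eval z (polyJ p) = conj (eval (quatJ z) p) := by
  unfold polyJ
  induction p using MvPolynomial.induction_on with
  | C a => simp [algebraMap_eq]
  | add p q hp hq => simp only [map_add, hp, hq]
  | mul_X p i hp =>
    obtain ⟨a, b⟩ := i
    simp only [map_mul, hp, map_X, aeval_X, eval_X]
    fin_cases b <;> simp [quatJ]

lemma isHomogeneous_polyJ {p : MvPolynomial (Fin 3 × Fin 2) ℂ} {k : ℕ} (hp : p.IsHomogeneous k) :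
    (polyJ p).IsHomogeneous k := by
  have := (hp.map (starRingEnd ℂ)).aeval (n := 1)
    (fun i : Fin 3 × Fin 2 => if i.2 = 0 then -X ((i.1, 1) : Fin 3 × Fin 2) else X (i.1, 0))
    (fun i => by
      split_ifs
      · exact (isHomogeneous_X ℂ _).neg
      · exact isHomogeneous_X ℂ _)
  rwa [one_mul] at this

lemma eval_quatJ (p : MvPolynomial (Fin 3 × Fin 2) ℂ) (z : Fin 3 × Fin 2 → ℂ) :
    eval (quatJ z) p = conj (eval z (polyJ p)) := by
  rw [eval_polyJ, Complex.conj_conj]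

lemma NearlyHolomorphic.integrable_mul {m : ℤ} {N : (Fin 3 × Fin 2 → ℂ) → ℂ}
    (hN : NearlyHolomorphic m N) (p q : MvPolynomial (Fin 3 × Fin 2) ℂ) :
    Integrable (fun z => N z * (eval z q * eval (quatJ z) p)) (gaussPi _) := by
  obtain ⟨C, hC⟩ := hN.bounded
  refine Integrable.bdd_mul (c := C) ?_ hN.measurable.aestronglyMeasurable
    (Eventually.of_forall fun z => hC z)
  simp_rw [eval_quatJ]
  exact integrable_mul_conj q (polyJ p)

/-- The bilinear form `∫ p(jz) N(z) q(z)` on polynomials. -/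
def jForm {m : ℤ} {N : (Fin 3 × Fin 2 → ℂ) → ℂ} (hN : NearlyHolomorphic m N) :
    MvPolynomial (Fin 3 × Fin 2) ℂ →ₗ[ℂ] MvPolynomial (Fin 3 × Fin 2) ℂ →ₗ[ℂ] ℂ :=
  LinearMap.mk₂ ℂ (fun p q => ∫ z, N z * (eval z q * eval (quatJ z) p) ∂gaussPi _)
    (fun p p' q => by
      rw [← integral_add (hN.integrable_mul _ _) (hN.integrable_mul _ _)]
      congr 1; ext z; rw [map_add]; ring)
    (fun c p q => by
      rw [smul_eq_mul, ← integral_const_mul]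
      congr 1; ext z; rw [smul_eval]; ring)
    (fun p q q' => by
      rw [← integral_add (hN.integrable_mul _ _) (hN.integrable_mul _ _)]
      congr 1; ext z; rw [map_add]; ring)
    (fun c p q => by
      rw [smul_eq_mul, ← integral_const_mul]
      congr 1; ext z; rw [smul_eval]; ring)

lemma jForm_apply {m : ℤ} {N : (Fin 3 × Fin 2 → ℂ) → ℂ} (hN : NearlyHolomorphic m N)
    (p q : MvPolynomial (Fin 3 × Fin 2) ℂ) :
    jForm hN p q = ∫ z, N z * (eval z q * eval (quatJ z) p) ∂gaussPi _ := rfl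

lemma jForm_swap {m n : ℤ} {M N : (Fin 3 × Fin 2 → ℂ) → ℂ} (hM : NearlyHolomorphic m M)
    (hN : NearlyHolomorphic n N) (h : ∀ z, M (quatJ z) = -N z)
    {p q : MvPolynomial (Fin 3 × Fin 2) ℂ} {k : ℕ} (hp : p.IsHomogeneous k) (hk : Even k) :
    jForm hM p q = -jForm hN q p := by
  rw [jForm_apply, jForm_apply, ← integral_neg]
  have hm : Measurable fun z => M z * (eval z q * eval (quatJ z) p) :=
    hM.measurable.mul ((measurable_eval_polynomial q).mul
      ((measurable_eval_polynomial p).comp quatJ_measurePreserving.measurable))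
  conv_lhs => rw [← quatJ_measurePreserving.map_eq]
  rw [integral_map quatJ_measurePreserving.measurable.aemeasurable hm.aestronglyMeasurable]
  congr 1
  ext z
  have := eval_smul_of_isHomogeneous hp (-1) z
  rw [hk.neg_one_pow, one_mul, neg_one_smul] at this
  rw [quatJ_quatJ, this, h]
  ring

lemma even_choose_five (n : ℕ) : Even ((8 * n + 9).choose 5) := by
  rw [Nat.even_iff]
  have h1 := Choose.choose_modEq_choose_mod_mul_choose_div_nat (p := 2) (n := 8 * n + 9) (k := 5)
  have h2 := Choose.choose_modEq_choose_mod_mul_choose_div_nat (p := 2) (n := 4 * n + 4) (k := 2)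
  rw [show (8 * n + 9) % 2 = 1 by omega, show (8 * n + 9) / 2 = 4 * n + 4 by omega] at h1
  rw [show (4 * n + 4) % 2 = 0 by omega, show (4 * n + 4) / 2 = 2 * n + 2 by omega] at h2
  simp only [Nat.ModEq] at h1 h2
  norm_num at h1 h2
  omega

lemma odd_choose_five (n : ℕ) : Odd ((8 * n + 5).choose 5) := by
  rw [Nat.odd_iff]
  have h1 := Choose.choose_modEq_choose_mod_mul_choose_div_nat (p := 2) (n := 8 * n + 5) (k := 5)
  have h2 := Choose.choose_modEq_choose_mod_mul_choose_div_nat (p := 2) (n := 4 * n + 2) (k := 2)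
  rw [show (8 * n + 5) % 2 = 1 by omega, show (8 * n + 5) / 2 = 4 * n + 2 by omega] at h1
  rw [show (4 * n + 2) % 2 = 0 by omega, show (4 * n + 2) / 2 = 2 * n + 1 by omega] at h2
  simp only [Nat.ModEq] at h1 h2
  norm_num at h1 h2
  omega

/-- Degree offsets of the four components. -/
def degOffset : Fin 4 → ℕ := ![0, 4, 2, 2]

/-- Indices of the monomial basis of quadruples of homogeneous polynomials. -/
abbrev MonoIndex (k : ℕ) : Type :=
  Σ s : Fin 4, (Finset.univ : Finset (Fin 3 × Fin 2)).finsuppAntidiag (k + degOffset s)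

lemma odd_card_monoIndex (n : ℕ) : Odd (Fintype.card (MonoIndex (8 * n))) := by
  have h : ∀ m, (Fintype.card (Fin 3 × Fin 2) + m - 1).choose m = (m + 5).choose 5 := by
    intro m
    rw [Fintype.card_prod, Fintype.card_fin, Fintype.card_fin,
      show 3 * 2 + m - 1 = 5 + m by omega, add_comm, Nat.choose_symm_add]
  simp only [Fintype.card_sigma, Fintype.card_coe, Finset.card_finsuppAntidiag_nat_eq_choose,
    Finset.card_univ, h, Fin.sum_univ_four]
  change Odd ((8 * n + 5).choose 5 + (8 * n + 9).choose 5 + (8 * n + 2 + 5).choose 5 +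
    (8 * n + 2 + 5).choose 5)
  rw [add_assoc, add_assoc]
  exact (odd_choose_five n).add_even ((even_choose_five n).add ⟨_, rfl⟩)

lemma det_eq_zero_of_skew {I : Type*} [Fintype I] [DecidableEq I] {A : Matrix I I ℂ}
    (hI : Odd (Fintype.card I)) (hA : A.transpose = -A) : A.det = 0 := by
  have h := congrArg Matrix.det hA
  rw [Matrix.det_transpose, Matrix.det_neg, hI.neg_one_pow] at h
  linear_combination h / 2

lemma isHomogeneous_monomial_monoIndex {k : ℕ} (i : MonoIndex k) (a : ℂ) :
    (monomial i.2.1 a).IsHomogeneous (k + degOffset i.1) := by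
  refine isHomogeneous_monomial a ?_
  have := (Finset.mem_finsuppAntidiag.1 i.2.2).1
  rw [Finsupp.degree_eq_sum]
  exact this

lemma sum_eq_zero_of_forall_monomial {κ ι : Type*} [Fintype κ]
    (B : κ → MvPolynomial ι ℂ →ₗ[ℂ] MvPolynomial ι ℂ →ₗ[ℂ] ℂ) (x : κ → MvPolynomial ι ℂ)
    {p : MvPolynomial ι ℂ} {k : ℕ} (hp : p.IsHomogeneous k)
    (h : ∀ α : ι →₀ ℕ, α.degree = k → ∑ t, B t (monomial α 1) (x t) = 0) :
    ∑ t, B t p (x t) = 0 := by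
  rw [p.as_sum]
  simp only [map_sum, LinearMap.sum_apply]
  rw [Finset.sum_comm]
  refine Finset.sum_eq_zero fun α hα => ?_
  have h2 : monomial α (coeff α p) = coeff α p • monomial α (1 : ℂ) := by
    rw [smul_monomial, smul_eq_mul, mul_one]
  simp only [h2, map_smul, LinearMap.smul_apply, ← Finset.smul_sum]
  rw [h α (by rw [← hp (mem_support_iff.1 hα), Finsupp.degree_eq_weight_one]; rfl), smul_zero]

/-- A system of skew forms `N` on quadruples of homogeneous polynomials is degenerate, by the
parity of the dimension. -/
lemma exists_forall_sum_jForm_eq_zero {N : Fin 4 → Fin 4 → (Fin 3 × Fin 2 → ℂ) → ℂ}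
    (hN : ∀ s t, NearlyHolomorphic ((degOffset s : ℤ) - degOffset t) (N s t))
    (hJ : ∀ s t z, N s t (quatJ z) = -N t s z) (n : ℕ) :
    ∃ x : Fin 4 → MvPolynomial (Fin 3 × Fin 2) ℂ,
      (∀ t, (x t).IsHomogeneous (8 * n + degOffset t)) ∧ (∃ t, x t ≠ 0) ∧
      ∀ s, ∀ p : MvPolynomial (Fin 3 × Fin 2) ℂ, p.IsHomogeneous (8 * n + degOffset s) →
        ∑ t, jForm (hN s t) p (x t) = 0 := by
  classical
  let A : Matrix (MonoIndex (8 * n)) (MonoIndex (8 * n)) ℂ :=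
    fun i j => jForm (hN i.1 j.1) (monomial i.2.1 1) (monomial j.2.1 1)
  have hA : A.transpose = -A := by
    ext i j
    refine jForm_swap (hN _ _) (hN _ _) (hJ _ _) (isHomogeneous_monomial_monoIndex _ _) ?_
    obtain ⟨s, -⟩ := j
    have h8 : Even (8 * n) := ⟨4 * n, by ring⟩
    fin_cases s <;> simp only [degOffset] <;> refine h8.add ?_ <;> decide
  obtain ⟨v, hv0, hv⟩ := Matrix.exists_mulVec_eq_zero_iff.2
    (det_eq_zero_of_skew (odd_card_monoIndex n) hA)
  refine ⟨fun t => ∑ α, monomial α.1 (v ⟨t, α⟩), fun t => ?_, ?_, fun s p hp => ?_⟩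
  · exact IsHomogeneous.sum _ _ _ fun α _ => isHomogeneous_monomial_monoIndex ⟨t, α⟩ _
  · obtain ⟨⟨t, α⟩, hα⟩ := Function.ne_iff.1 hv0
    refine ⟨t, fun h0 => hα ?_⟩
    have := congrArg (coeff α.1) h0
    simp only [coeff_sum, coeff_monomial, coeff_zero] at this
    rw [Finset.sum_eq_single α (fun β _ hβ => if_neg fun h => hβ (Subtype.ext h)) (by simp),
      if_pos rfl] at this
    exact this
  · have key : ∀ α, α ∈ (Finset.univ : Finset (Fin 3 × Fin 2)).finsuppAntidiag
        (8 * n + degOffset s) → ∑ t, jForm (hN s t) (monomial α 1)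
          (∑ β, monomial β.1 (v ⟨t, β⟩)) = 0 := by
      intro α hα
      have := congrFun hv ⟨s, α, hα⟩
      simp only [Matrix.mulVec, dotProduct, Fintype.sum_sigma, Pi.zero_apply, A] at this
      rw [← this]
      refine Finset.sum_congr rfl fun t _ => ?_
      rw [map_sum]
      refine Finset.sum_congr rfl fun β _ => ?_
      have : monomial β.1 (v ⟨t, β⟩) = v ⟨t, β⟩ • monomial β.1 (1 : ℂ) := by
        rw [smul_monomial, smul_eq_mul, mul_one]
      rw [this, map_smul, smul_eq_mul, mul_comm]
    refine sum_eq_zero_of_forall_monomial (fun t => jForm (hN s t)) _ hp fun α hα => key α ?_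
    rw [Finset.mem_finsuppAntidiag, ← hα, Finsupp.degree_eq_sum]
    exact ⟨rfl, Finset.subset_univ _⟩

end SkewForm

section Degenerate
open MeasureTheory ComplexConjugate MvPolynomial Filter
open scoped NNReal ENNReal

section
variable {ι : Type} [Fintype ι]

lemma gaussNorm_sum_le {κ : Type*} (s : Finset κ) {F : κ → (ι → ℂ) → ℂ}
    (hF : ∀ i, Measurable (F i)) :
    gaussNorm (fun z => ∑ i ∈ s, F i z) ≤ ∑ i ∈ s, gaussNorm (F i) := by
  classical
  induction s using Finset.induction_on with
  | empty => simp [gaussNorm]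
  | insert a s ha ih =>
    simp only [Finset.sum_insert ha]
    exact (gaussNorm_add_le (hF a) (Finset.measurable_fun_sum s fun i _ => hF i)).trans
      (add_le_add le_rfl ih)

lemma gaussNorm_eval_ne_top (p : MvPolynomial ι ℂ) : gaussNorm (fun z => eval z p) ≠ ⊤ := by
  rw [gaussNorm_eval]
  exact ENNReal.ofReal_ne_top

lemma fockInner_monomial_right (p : MvPolynomial ι ℂ) (β : ι →₀ ℕ) :
    fockInner p (monomial β 1) = coeff β p * ∏ i, ((β i).factorial : ℂ) := by
  classical
  induction p using MvPolynomial.induction_on' with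
  | add p q hp hq => rw [fockInner_add_left, hp, hq, coeff_add, add_mul]
  | monomial α a =>
    rw [fockInner_monomial, coeff_monomial]
    split_ifs with h
    · subst h; simp
    · simp

lemma eq_zero_of_gaussNorm_eq_zero {p : MvPolynomial ι ℂ} (h : gaussNorm (fun z => eval z p) = 0) :
    p = 0 := by
  have h0 := (eLpNorm_eq_zero_iff (measurable_eval_polynomial p).aestronglyMeasurable
    (by norm_num)).1 h
  ext β
  have h1 : fockInner p (monomial β 1) = 0 := by
    unfold fockInner
    rw [integral_congr_ae (g := fun _ => 0), integral_zero]
    filter_upwards [h0] with z hz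
    rw [hz]
    simp
  rw [fockInner_monomial_right, mul_eq_zero, Finset.prod_eq_zero_iff] at h1
  rcases h1 with h1 | ⟨i, -, hi⟩
  · simpa using h1
  · exact absurd hi (by exact_mod_cast (Nat.factorial_pos _).ne')

lemma gaussNorm_le_sub_of_orthogonal {y : (ι → ℂ) → ℂ} (hy : MemLp y 2 (gaussPi ι))
    (hm : Measurable y) {q : MvPolynomial ι ℂ}
    (h : ∫ z, y z * conj (eval z q) ∂gaussPi ι = 0) :
    gaussNorm y ≤ gaussNorm fun z => y z - eval z q := by
  have mq := measurable_eval_polynomial q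
  have hq : MemLp (fun z => eval z q) 2 (gaussPi ι) :=
    (memLp_two_iff_integrable_sq_norm mq.aestronglyMeasurable).2 (integrable_norm_sq_eval q)
  have hyi := (memLp_two_iff_integrable_sq_norm hm.aestronglyMeasurable).1 hy
  have hdi := (memLp_two_iff_integrable_sq_norm
    (hm.sub mq).aestronglyMeasurable).1 (hy.sub hq)
  have hyq : Integrable (fun z => y z * conj (eval z q)) (gaussPi ι) :=
    hy.integrable_mul hq.star
  have hre : ∫ z, (y z * conj (eval z q)).re ∂gaussPi ι = 0 := by
    have := integral_re hyq
    rw [h] at this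
    simpa using this
  rw [gaussNorm_eq hm hyi, show (fun z => y z - eval z q) = y - fun z => eval z q from rfl,
    gaussNorm_eq (hm.sub mq) hdi]
  refine ENNReal.ofReal_le_ofReal (Real.sqrt_le_sqrt ?_)
  have e : ∀ z, ‖(y - fun z => eval z q) z‖ ^ 2 =
      ‖y z‖ ^ 2 + (‖eval z q‖ ^ 2 - 2 * (y z * conj (eval z q)).re) := by
    intro z
    simp only [Pi.sub_apply, ← Complex.normSq_eq_norm_sq, Complex.normSq_sub]
    ring
  have hz : ∫ z, ‖(y - fun z => eval z q) z‖ ^ 2 ∂gaussPi ι =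
      ∫ z, ‖y z‖ ^ 2 ∂gaussPi ι + fockNormSq q := by
    have hi : Integrable (fun z => 2 * (y z * conj (eval z q)).re) (gaussPi ι) :=
      hyq.re.const_mul 2
    have hi' : Integrable (fun z => ‖eval z q‖ ^ 2 - 2 * (y z * conj (eval z q)).re) (gaussPi ι) :=
      (integrable_norm_sq_eval q).sub hi
    simp_rw [e]
    rw [integral_add hyi hi', integral_sub (integrable_norm_sq_eval q) hi, integral_const_mul, hre,
      mul_zero, sub_zero, fockNormSq]
  exact (le_add_of_nonneg_right (fockNormSq_nonneg q)).trans hz.ge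

lemma NearlyHolomorphic.memLp_mul {m : ℤ} {N : (ι → ℂ) → ℂ}
    (hN : NearlyHolomorphic m N) (p : MvPolynomial ι ℂ) :
    MemLp (fun z => N z * eval z p) 2 (gaussPi ι) := by
  obtain ⟨C, hC⟩ := hN.bounded
  have mp := measurable_eval_polynomial p
  have hq : MemLp (fun z => eval z p) 2 (gaussPi ι) :=
    (memLp_two_iff_integrable_sq_norm mp.aestronglyMeasurable).2 (integrable_norm_sq_eval p)
  refine hq.of_le_mul (c := C) (hN.measurable.mul mp).aestronglyMeasurable
    (Eventually.of_forall fun z => ?_)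
  rw [norm_mul]
  exact mul_le_mul_of_nonneg_right (hC z) (norm_nonneg _)

end

/-- The index argument: a system of skew symbols on quadruples of homogeneous polynomials
cannot be uniformly invertible. -/
theorem not_skew_invertible {N : Fin 4 → Fin 4 → (Fin 3 × Fin 2 → ℂ) → ℂ}
    (hN : ∀ s t, NearlyHolomorphic ((degOffset s : ℤ) - degOffset t) (N s t))
    (hJ : ∀ s t z, N s t (quatJ z) = -N t s z) {δ : ℝ≥0} (hδ : 0 < δ)
    (hinv : ∀ z ≠ 0, ∀ (x : Fin 4 → ℂ) (t : Fin 4), δ * ‖x t‖₊ ≤ ∑ s, ‖∑ t, N s t z * x t‖₊) :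
    False := by
  choose K hK using fun s t => (hN s t).approx (δ / 32) (by positivity)
  obtain ⟨L, hL⟩ : ∃ L : ℕ, ∀ s t, K s t ≤ L :=
    ⟨∑ s, ∑ t, K s t, fun s t => (Finset.single_le_sum (f := fun t => K s t)
      (fun _ _ => Nat.zero_le _) (Finset.mem_univ t)).trans
      (Finset.single_le_sum (f := fun s => ∑ t, K s t) (fun _ _ => Nat.zero_le _)
        (Finset.mem_univ s))⟩
  set n := L + 1 with hn
  obtain ⟨x, hx, ⟨t₀, ht₀⟩, horth⟩ := exists_forall_sum_jForm_eq_zero hN hJ n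
  set S : ℝ≥0∞ := ∑ t, gaussNorm fun z => eval z (x t) with hS
  have hS_top : S ≠ ⊤ := ENNReal.sum_ne_top.2 fun t _ => gaussNorm_eval_ne_top _
  have mx := fun t => measurable_eval_polynomial (x t)
  have mN := fun s t => (hN s t).measurable
  have my : ∀ s, Measurable fun z => ∑ t, N s t z * eval z (x t) := fun s =>
    Finset.measurable_fun_sum _ fun t _ => (mN s t).mul (mx t)
  have upper : ∀ s, gaussNorm (fun z => ∑ t, N s t z * eval z (x t)) ≤
      (δ / 32 : ℝ≥0) * S := by
    intro s
    choose q hq hqn using fun t => hK s t (8 * n + degOffset t) (by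
      have := hL s t
      omega) (8 * n + degOffset s) (by push_cast; ring) (x t) (hx t)
    have hsum : (∑ t, q t).IsHomogeneous (8 * n + degOffset s) :=
      IsHomogeneous.sum _ _ _ fun t _ => hq t
    have h0 : ∫ z, (∑ t, N s t z * eval z (x t)) * conj (eval z (∑ t, q t)) ∂gaussPi _ = 0 := by
      have he : Even (8 * n + degOffset s) := by
        have h8 : Even (8 * n) := ⟨4 * n, by ring⟩
        fin_cases s <;> simp only [degOffset] <;> refine h8.add ?_ <;> decide
      have h1 := horth s _ (isHomogeneous_polyJ hsum)
      simp only [jForm_apply] at h1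
      rw [← integral_finsetSum _ fun t _ => (hN s t).integrable_mul _ _] at h1
      rw [← h1]
      congr 1
      ext z
      have h2 := eval_smul_of_isHomogeneous hsum (-1) z
      rw [he.neg_one_pow, one_mul, neg_one_smul] at h2
      rw [eval_polyJ, quatJ_quatJ, h2, Finset.sum_mul]
      exact Finset.sum_congr rfl fun t _ => by ring
    refine (gaussNorm_le_sub_of_orthogonal
      (memLp_finsetSum _ fun t _ => (hN s t).memLp_mul (x t)) (my s) h0).trans ?_
    have e : (fun z => ∑ t, N s t z * eval z (x t) - eval z (∑ t, q t)) =
        fun z => ∑ t, (N s t z * eval z (x t) - eval z (q t)) := by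
      ext z
      rw [map_sum, Finset.sum_sub_distrib]
    rw [e]
    refine (gaussNorm_sum_le _ fun t => ((mN s t).mul (mx t)).sub
      (measurable_eval_polynomial (q t))).trans ?_
    rw [hS, Finset.mul_sum]
    exact Finset.sum_le_sum fun t _ => hqn t
  have lower : ∀ t, (δ : ℝ≥0∞) * gaussNorm (fun z => eval z (x t)) ≤ δ / 8 * S := by
    intro t
    have h1 : gaussNorm (fun z => eval z (x t)) ≤ (δ⁻¹ : ℝ≥0) *
        gaussNorm fun z => ((∑ s, ‖∑ t, N s t z * eval z (x t)‖ : ℝ) : ℂ) := by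
      refine gaussNorm_le_mul fun z => ?_
      by_cases hz : z = 0
      · have := eval_smul_of_isHomogeneous (hx t) 0 z
        rw [zero_smul, zero_pow (by omega), zero_mul] at this
        rw [hz, this]
        simp
      · rw [← div_eq_inv_mul, le_div_iff₀' hδ]
        refine (hinv z hz (fun t => eval z (x t)) t).trans (le_of_eq ?_)
        rw [← NNReal.coe_inj]
        rw [coe_nnnorm, Complex.norm_real,
          Real.norm_of_nonneg (Finset.sum_nonneg fun _ _ => norm_nonneg _)]
        push_cast
        rfl
    have h2 : gaussNorm (fun z => ((∑ s, ‖∑ t, N s t z * eval z (x t)‖ : ℝ) : ℂ)) ≤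
        ∑ s, gaussNorm fun z => ∑ t, N s t z * eval z (x t) := by
      simp only [Complex.ofReal_sum]
      refine (gaussNorm_sum_le _ fun s =>
        Complex.measurable_ofReal.comp (my s).norm).trans (Finset.sum_le_sum fun s _ => ?_)
      refine (gaussNorm_le_mul (c := 1) fun z => ?_).trans
        (le_of_eq (by rw [ENNReal.coe_one, one_mul]))
      simp
    have h3 : gaussNorm (fun z => ((∑ s, ‖∑ t, N s t z * eval z (x t)‖ : ℝ) : ℂ)) ≤
        (δ / 8 : ℝ≥0) * S := by
      refine h2.trans ((Finset.sum_le_sum fun s _ => upper s).trans (le_of_eq ?_))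
      rw [Finset.sum_const, Finset.card_univ, Fintype.card_fin, nsmul_eq_mul, ← mul_assoc]
      congr 1
      have : ((4 : ℕ) : ℝ≥0∞) = ((4 : ℝ≥0) : ℝ≥0∞) := by simp
      rw [this, ← ENNReal.coe_mul]
      congr 1
      rw [← NNReal.coe_inj]
      push_cast
      ring
    calc (δ : ℝ≥0∞) * gaussNorm (fun z => eval z (x t))
        ≤ δ * ((δ⁻¹ : ℝ≥0) * ((δ / 8 : ℝ≥0) * S)) :=
          mul_le_mul_right (h1.trans (mul_le_mul_right h3 _)) _
      _ = δ / 8 * S := by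
          rw [← mul_assoc, ← ENNReal.coe_mul, mul_inv_cancel₀ hδ.ne', ENNReal.coe_one, one_mul,
            ENNReal.coe_div (by norm_num)]
          rfl
  have total : (δ : ℝ≥0∞) * S ≤ δ / 2 * S := by
    rw [hS, Finset.mul_sum]
    refine (Finset.sum_le_sum fun t _ => lower t).trans (le_of_eq ?_)
    rw [Finset.sum_const, Finset.card_univ, Fintype.card_fin, nsmul_eq_mul, ← mul_assoc]
    congr 1
    have e1 : (δ : ℝ≥0∞) / 8 = ((δ / 8 : ℝ≥0) : ℝ≥0∞) := by
      rw [ENNReal.coe_div (by norm_num)]; rfl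
    have e2 : (δ : ℝ≥0∞) / 2 = ((δ / 2 : ℝ≥0) : ℝ≥0∞) := by
      rw [ENNReal.coe_div (by norm_num)]; rfl
    have e3 : ((4 : ℕ) : ℝ≥0∞) = ((4 : ℝ≥0) : ℝ≥0∞) := by simp
    rw [e1, e2, e3, ← ENNReal.coe_mul]
    congr 1
    rw [← NNReal.coe_inj]
    push_cast
    ring
  have hS0 : S = 0 := by
    by_contra h0
    have h1 := (ENNReal.mul_le_mul_iff_left h0 hS_top).1 total
    exact absurd h1 (not_le.2 (ENNReal.half_lt_self (by simpa using hδ.ne') ENNReal.coe_ne_top))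
  refine ht₀ (eq_zero_of_gaussNorm_eq_zero ?_)
  exact (Finset.sum_eq_zero_iff.1 hS0) t₀ (Finset.mem_univ _)

end Degenerate

section Equivariant
open ComplexConjugate
open scoped NNReal

/-- The quaternion with the given components. -/
def mkH (a b c d : ℝ) : ℍ[ℝ] := ⟨a, b, c, d⟩

@[simp] lemma mkH_re (a b c d : ℝ) : (mkH a b c d).re = a := rfl
@[simp] lemma mkH_imI (a b c d : ℝ) : (mkH a b c d).imI = b := rfl
@[simp] lemma mkH_imJ (a b c d : ℝ) : (mkH a b c d).imJ = c := rfl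
@[simp] lemma mkH_imK (a b c d : ℝ) : (mkH a b c d).imK = d := rfl

@[simp] lemma cq_re (c : ℂ) : (cq c).re = c.re := rfl
@[simp] lemma cq_imI (c : ℂ) : (cq c).imI = c.im := rfl
@[simp] lemma cq_imJ (c : ℂ) : (cq c).imJ = 0 := rfl
@[simp] lemma cq_imK (c : ℂ) : (cq c).imK = 0 := rfl

lemma cq_inv {c : ℂ} (hc : c ≠ 0) : (cq c)⁻¹ = cq c⁻¹ := by
  have hmul : cq c * cq c⁻¹ = 1 := by
    have h := mul_inv_cancel₀ hc
    have h1 := congrArg Complex.re h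
    have h2 := congrArg Complex.im h
    rw [Complex.mul_re, Complex.one_re] at h1
    rw [Complex.mul_im, Complex.one_im] at h2
    ext
    · simpa only [Quaternion.re_mul, cq_re, cq_imI, cq_imJ, cq_imK, mul_zero, sub_zero,
        Quaternion.re_one] using h1
    · simpa only [Quaternion.imI_mul, cq_re, cq_imI, cq_imJ, cq_imK, mul_zero, sub_zero,
        add_zero, Quaternion.imI_one] using h2
    · simp
    · simp
  exact inv_eq_of_mul_eq_one_right hmul

/-- The identification of `ℂ⁶` with `ℍ³`, sending `(z, w)` to `z + j w` in each coordinate. -/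
def vecH (z : Fin 3 × Fin 2 → ℂ) : Fin 3 → ℍ[ℝ] :=
  fun a => mkH (z (a, 0)).re (z (a, 0)).im (z (a, 1)).re (-(z (a, 1)).im)

lemma vecH_smul (c : ℂ) (z : Fin 3 × Fin 2 → ℂ) : vecH (c • z) = fun a => vecH z a * cq c := by
  ext a <;> simp [vecH] <;> ring

lemma vecH_quatJ (z : Fin 3 × Fin 2 → ℂ) :
    vecH (quatJ z) = fun a => vecH z a * mkH 0 0 1 0 := by
  ext a <;> simp [vecH, quatJ]

lemma vecH_ne_zero {z : Fin 3 × Fin 2 → ℂ} (hz : z ≠ 0) : vecH z ≠ 0 := by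
  contrapose! hz
  ext ⟨a, b⟩
  have h := congrFun hz a
  have h1 := congrArg QuaternionAlgebra.re h
  have h2 := congrArg QuaternionAlgebra.imI h
  have h3 := congrArg QuaternionAlgebra.imJ h
  have h4 := congrArg QuaternionAlgebra.imK h
  simp [vecH] at h1 h2 h3 h4
  fin_cases b
  · exact Complex.ext h1 h2
  · exact Complex.ext h3 h4

lemma continuous_mkH {X : Type*} [TopologicalSpace X] {a b c d : X → ℝ}
    (ha : Continuous a) (hb : Continuous b) (hc : Continuous c) (hd : Continuous d) :
    Continuous fun x => mkH (a x) (b x) (c x) (d x) := by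
  have : (fun x => mkH (a x) (b x) (c x) (d x)) = fun x =>
      a x • (1 : ℍ[ℝ]) + b x • mkH 0 1 0 0 + c x • mkH 0 0 1 0 + d x • mkH 0 0 0 1 := by
    ext x <;> simp
  rw [this]
  fun_prop

lemma continuous_vecH : Continuous vecH :=
  continuous_pi fun a => continuous_mkH (by fun_prop) (by fun_prop) (by fun_prop) (by fun_prop)

/-- The matrix symbol built from functions of weights `0`, `2` and `2`. -/
def skewSymbol (G η θ : ℂ) : Fin 4 → Fin 4 → ℂ :=
  ![![G, 0, conj η, conj θ], ![0, G, -θ, η], ![-η, conj θ, conj G, 0], ![-θ, -conj η, 0, conj G]]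

lemma skewSymbol_sum_sq (G η θ : ℂ) (x : Fin 4 → ℂ) :
    ∑ s, ‖∑ t, skewSymbol G η θ s t * x t‖ ^ 2 =
      (‖G‖ ^ 2 + ‖η‖ ^ 2 + ‖θ‖ ^ 2) * ∑ t, ‖x t‖ ^ 2 := by
  simp only [Fin.sum_univ_four, skewSymbol, ← Complex.normSq_eq_norm_sq, Complex.normSq_apply]
  simp
  ring

lemma skewSymbol_lower_bound {δ : ℝ≥0} {G η θ : ℂ} (h : (δ : ℝ) ^ 2 ≤ ‖G‖ ^ 2 + ‖η‖ ^ 2 + ‖θ‖ ^ 2)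
    (x : Fin 4 → ℂ) (t : Fin 4) :
    δ * ‖x t‖₊ ≤ ∑ s, ‖∑ t, skewSymbol G η θ s t * x t‖₊ := by
  rw [← NNReal.coe_le_coe]
  push_cast
  refine le_of_pow_le_pow_left₀ two_ne_zero (Finset.sum_nonneg fun _ _ => norm_nonneg _) ?_
  calc ((δ : ℝ) * ‖x t‖) ^ 2 = (δ : ℝ) ^ 2 * ‖x t‖ ^ 2 := mul_pow _ _ _
    _ ≤ (‖G‖ ^ 2 + ‖η‖ ^ 2 + ‖θ‖ ^ 2) * ∑ t, ‖x t‖ ^ 2 := by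
        refine mul_le_mul h ?_ (by positivity) (by positivity)
        exact Finset.single_le_sum (f := fun t => ‖x t‖ ^ 2) (fun _ _ => by positivity)
          (Finset.mem_univ t)
    _ = _ := (skewSymbol_sum_sq G η θ x).symm
    _ ≤ _ := Finset.sum_sq_le_sq_sum_of_nonneg fun _ _ => norm_nonneg _

/-- The complex coordinate of a pair of quaternions that is invariant under conjugation by
complex numbers. -/
def axisPart (p q : ℍ[ℝ]) : ℂ := ⟨p.imI, q.imI⟩

/-- The complex coordinate of a quaternion that has weight `2` under conjugation by unit complex
numbers. -/
def twistPart (q : ℍ[ℝ]) : ℂ := ⟨q.imJ, -q.imK⟩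

lemma continuous_complex_mk {X : Type*} [TopologicalSpace X] {a b : X → ℝ}
    (ha : Continuous a) (hb : Continuous b) : Continuous fun x => (⟨a x, b x⟩ : ℂ) := by
  have : (fun x => (⟨a x, b x⟩ : ℂ)) = fun x => (a x : ℂ) + b x * Complex.I := by
    funext x
    apply Complex.ext <;> simp
  rw [this]
  fun_prop

lemma continuous_axisPart : Continuous fun p : ℍ[ℝ] × ℍ[ℝ] => axisPart p.1 p.2 :=
  continuous_complex_mk (Quaternion.continuous_imI.comp continuous_fst)
    (Quaternion.continuous_imI.comp continuous_snd)

lemma continuous_twistPart : Continuous twistPart :=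
  continuous_complex_mk Quaternion.continuous_imJ Quaternion.continuous_imK.neg

lemma sq_add_sq_of_norm_eq_one {c : ℂ} (hc : ‖c‖ = 1) : c.re ^ 2 + c.im ^ 2 = 1 := by
  rw [← Complex.normSq_add_mul_I, Complex.re_add_im, Complex.normSq_eq_norm_sq, hc, one_pow]

lemma cq_inv_of_norm_eq_one {c : ℂ} (hc : ‖c‖ = 1) : (cq c)⁻¹ = cq (conj c) := by
  rw [cq_inv (norm_ne_zero_iff.1 (by rw [hc]; exact one_ne_zero)), Complex.inv_eq_conj hc]

lemma imI_conj_cq {c : ℂ} (hc : ‖c‖ = 1) (q : ℍ[ℝ]) :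
    ((cq c)⁻¹ * q * cq c).imI = q.imI := by
  rw [cq_inv_of_norm_eq_one hc]
  simp
  linear_combination q.imI * sq_add_sq_of_norm_eq_one hc

lemma axisPart_conj_cq {c : ℂ} (hc : ‖c‖ = 1) (p q : ℍ[ℝ]) :
    axisPart ((cq c)⁻¹ * p * cq c) ((cq c)⁻¹ * q * cq c) = axisPart p q := by
  rw [axisPart, imI_conj_cq hc, imI_conj_cq hc, axisPart]

lemma twistPart_conj_cq {c : ℂ} (hc : ‖c‖ = 1) (q : ℍ[ℝ]) :
    twistPart ((cq c)⁻¹ * q * cq c) = c ^ 2 * twistPart q := by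
  rw [cq_inv_of_norm_eq_one hc]
  apply Complex.ext <;> simp [twistPart, pow_two] <;> ring

lemma mkH_j_inv : (mkH 0 0 1 0)⁻¹ = mkH 0 0 (-1) 0 := by
  refine inv_eq_of_mul_eq_one_right ?_
  ext <;> simp

lemma mkH_j_ne_zero : mkH 0 0 1 0 ≠ 0 := fun h => one_ne_zero (congrArg QuaternionAlgebra.imJ h)

lemma axisPart_conj_j (p q : ℍ[ℝ]) :
    axisPart ((mkH 0 0 1 0)⁻¹ * p * mkH 0 0 1 0) ((mkH 0 0 1 0)⁻¹ * q * mkH 0 0 1 0) =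
      -axisPart p q := by
  rw [mkH_j_inv]
  apply Complex.ext <;> simp [axisPart]

lemma twistPart_conj_j (q : ℍ[ℝ]) :
    twistPart ((mkH 0 0 1 0)⁻¹ * q * mkH 0 0 1 0) = conj (twistPart q) := by
  rw [mkH_j_inv]
  apply Complex.ext <;> simp [twistPart]

lemma conj_cq_ofReal {t : ℝ} (ht : t ≠ 0) (q : ℍ[ℝ]) : (cq t)⁻¹ * q * cq t = q := by
  have h : cq t = (t : ℍ[ℝ]) := by ext <;> simp
  rw [h, mul_assoc, ← (Quaternion.coe_commutes t q), ← mul_assoc, inv_mul_cancel₀, one_mul]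
  exact fun h0 => ht (congrArg QuaternionAlgebra.re h0)

open Classical in
/-- A function on nonzero vectors of `ℍ³`, in complex coordinates and extended by zero. -/
def coordExt (f : V3x → ℍ[ℝ]) (z : Fin 3 × Fin 2 → ℂ) : ℍ[ℝ] :=
  if h : z = 0 then 0 else f ⟨vecH z, vecH_ne_zero h⟩

/-- Equivariance of a function on nonzero vectors of `ℍ³` under right multiplication by nonzero
quaternions, which act on the target by conjugation. -/
def ConjEquivariant (f : V3x → ℍ[ℝ]) : Prop :=
  ∀ (v w : V3x) (b : ℍ[ℝ]), b ≠ 0 → (w.1 = fun a => v.1 a * b) → f w = b⁻¹ * f v * b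

lemma coordExt_zero (f : V3x → ℍ[ℝ]) : coordExt f 0 = 0 := dif_pos rfl

lemma ConjEquivariant.coordExt_eq {f : V3x → ℍ[ℝ]} (hf : ConjEquivariant f)
    {z w : Fin 3 × Fin 2 → ℂ} {b : ℍ[ℝ]} (hb : b ≠ 0) (h0 : w = 0 ↔ z = 0)
    (hw : vecH w = fun a => vecH z a * b) : coordExt f w = b⁻¹ * coordExt f z * b := by
  by_cases hz : z = 0
  · rw [hz, h0.2 hz, coordExt_zero, mul_zero, zero_mul]
  · rw [coordExt, coordExt, dif_neg hz, dif_neg (mt h0.1 hz)]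
    exact hf _ _ b hb hw

lemma ConjEquivariant.coordExt_smul {f : V3x → ℍ[ℝ]} (hf : ConjEquivariant f) {c : ℂ}
    (hc : c ≠ 0) (z : Fin 3 × Fin 2 → ℂ) :
    coordExt f (c • z) = (cq c)⁻¹ * coordExt f z * cq c :=
  hf.coordExt_eq (cq_ne_zero hc) (by simp [hc]) (vecH_smul c z)

lemma quatJ_eq_zero_iff {z : Fin 3 × Fin 2 → ℂ} : quatJ z = 0 ↔ z = 0 := by
  constructor
  · intro h
    ext ⟨a, b⟩
    have h0 := congrFun h (a, 0)
    have h1 := congrFun h (a, 1)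
    simp only [quatJ, Pi.zero_apply] at h0 h1
    fin_cases b
    · simpa using h1
    · simpa using h0
  · rintro rfl
    ext i
    simp [quatJ]

lemma ConjEquivariant.coordExt_quatJ {f : V3x → ℍ[ℝ]} (hf : ConjEquivariant f)
    (z : Fin 3 × Fin 2 → ℂ) :
    coordExt f (quatJ z) = (mkH 0 0 1 0)⁻¹ * coordExt f z * mkH 0 0 1 0 :=
  hf.coordExt_eq mkH_j_ne_zero quatJ_eq_zero_iff (vecH_quatJ z)

lemma continuousOn_coordExt {f : V3x → ℍ[ℝ]} (hf : Continuous f) :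
    ContinuousOn (coordExt f) {0}ᶜ := by
  rw [continuousOn_iff_continuous_domRestrict]
  have : ({0}ᶜ : Set (Fin 3 × Fin 2 → ℂ)).domRestrict (coordExt f) =
      fun z => f ⟨vecH z.1, vecH_ne_zero z.2⟩ := by
    ext1 z
    exact dif_neg z.2
  rw [this]
  exact hf.comp ((continuous_vecH.comp continuous_subtype_val).subtype_mk _)

lemma nearlyHolomorphic_coordExt {m : ℤ} {Φ : ℍ[ℝ] × ℍ[ℝ] → ℂ} (hΦ : Continuous Φ)
    (h0 : Φ 0 = 0)
    (hw : ∀ c : ℂ, ‖c‖ = 1 → ∀ p q,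
      Φ ((cq c)⁻¹ * p * cq c, (cq c)⁻¹ * q * cq c) = c ^ m * Φ (p, q))
    {f g : V3x → ℍ[ℝ]} (hf : Continuous f) (hg : Continuous g) (hf' : ConjEquivariant f)
    (hg' : ConjEquivariant g) :
    NearlyHolomorphic m fun z => Φ (coordExt f z, coordExt g z) := by
  refine NearlyHolomorphic.of_continuousOn ?_ ?_ ?_ ?_
  · rw [coordExt_zero, coordExt_zero]
    exact h0
  · exact hΦ.comp_continuousOn ((continuousOn_coordExt hf).prodMk (continuousOn_coordExt hg))
  · intro t z ht
    have ht' : (t : ℂ) ≠ 0 := by exact_mod_cast ht.ne'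
    rw [hf'.coordExt_smul ht', hg'.coordExt_smul ht', conj_cq_ofReal ht.ne',
      conj_cq_ofReal ht.ne']
  · intro c z hc
    have hc' : c ≠ 0 := norm_ne_zero_iff.1 (by rw [hc]; exact one_ne_zero)
    rw [hf'.coordExt_smul hc', hg'.coordExt_smul hc', hw c hc]

lemma conj_zpow_of_norm_eq_one {c : ℂ} (hc : ‖c‖ = 1) (m : ℤ) : conj (c ^ m) = c ^ (-m) := by
  rw [map_zpow₀, ← Complex.inv_eq_conj hc, inv_zpow, zpow_neg]

lemma exists_coordExt_lower_bound {f g : V3x → ℍ[ℝ]} (hf : Continuous f) (hg : Continuous g)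
    (hf' : ConjEquivariant f) (hg' : ConjEquivariant g) (hne : ∀ v, f v ≠ 0 ∨ g v ≠ 0) :
    ∃ δ : ℝ≥0, 0 < δ ∧ ∀ z ≠ 0, (δ : ℝ) ^ 2 ≤ ‖coordExt f z‖ ^ 2 + ‖coordExt g z‖ ^ 2 := by
  let S : Set (Fin 3 × Fin 2 → ℂ) := {z | euclSq z = 1}
  have hS0 : ∀ z ∈ S, z ≠ 0 := by
    rintro z hz rfl
    simp [S, euclSq] at hz
  have hcont : ContinuousOn (fun z => ‖coordExt f z‖ ^ 2 + ‖coordExt g z‖ ^ 2) S :=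
    (((continuousOn_coordExt hf).norm.pow 2).add ((continuousOn_coordExt hg).norm.pow 2)).mono hS0
  have hcpt : IsCompact S :=
    isCompact_iff_compactSpace.2 (inferInstanceAs (CompactSpace (CSphere _)))
  have hpos : ∀ z ≠ 0, 0 < ‖coordExt f z‖ ^ 2 + ‖coordExt g z‖ ^ 2 := by
    intro z hz
    rw [coordExt, coordExt, dif_neg hz, dif_neg hz]
    rcases hne ⟨vecH z, vecH_ne_zero hz⟩ with h | h
    · have := norm_pos_iff.2 h
      positivity
    · have := norm_pos_iff.2 h
      positivity
  have hSne : S.Nonempty := ⟨_, (toCSphere (Function.const _ (1 : ℂ)) fun h =>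
    one_ne_zero (congrFun h (0, 0))).2⟩
  obtain ⟨w, hwS, hw⟩ := hcpt.exists_isMinOn hSne hcont
  refine ⟨Real.toNNReal √(‖coordExt f w‖ ^ 2 + ‖coordExt g w‖ ^ 2),
    Real.toNNReal_pos.2 (Real.sqrt_pos.2 (hpos w (hS0 w hwS))), fun z hz => ?_⟩
  rw [Real.coe_toNNReal _ (Real.sqrt_nonneg _), Real.sq_sqrt (by positivity)]
  have h := hw (toCSphere z hz).2
  have ht : (√(euclSq z))⁻¹ ≠ 0 := (inv_pos.2 (Real.sqrt_pos.2 (euclSq_pos hz))).ne'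
  have ht' : (((√(euclSq z))⁻¹ : ℝ) : ℂ) ≠ 0 := by exact_mod_cast ht
  simp only [toCSphere, Set.mem_ofPred_eq] at h
  rwa [hf'.coordExt_smul ht', hg'.coordExt_smul ht', conj_cq_ofReal ht, conj_cq_ofReal ht] at h

lemma norm_sq_symbol {p q : ℍ[ℝ]} (hp : p.re = 0) (hq : q.re = 0) :
    ‖axisPart p q‖ ^ 2 + ‖twistPart p‖ ^ 2 + ‖twistPart q‖ ^ 2 = ‖p‖ ^ 2 + ‖q‖ ^ 2 := by
  simp only [← Complex.normSq_eq_norm_sq, Complex.normSq_apply, axisPart, twistPart,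
    ← Quaternion.normSq_eq_norm_mul_self, pow_two ‖p‖, pow_two ‖q‖, Quaternion.normSq_def', hp, hq]
  ring

/-- Two continuous conjugation-equivariant functions from nonzero vectors of `ℍ³` to the imaginary
quaternions have a common zero. -/
theorem ConjEquivariant.exists_common_zero {f g : V3x → ℍ[ℝ]} (hf : Continuous f)
    (hg : Continuous g) (hf' : ConjEquivariant f) (hg' : ConjEquivariant g)
    (hfre : ∀ v, (f v).re = 0) (hgre : ∀ v, (g v).re = 0) : ∃ v, f v = 0 ∧ g v = 0 := by
  by_contra! hne
  obtain ⟨δ, hδ, hbound⟩ := exists_coordExt_lower_bound hf hg hf' hg' fun v => by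
    by_cases h : f v = 0
    · exact Or.inr (hne v h)
    · exact Or.inl h
  have hre : ∀ {h : V3x → ℍ[ℝ]}, (∀ v, (h v).re = 0) → ∀ z, (coordExt h z).re = 0 := by
    intro h hh z
    by_cases hz : z = 0
    · rw [hz, coordExt_zero, Quaternion.re_zero]
    · rw [coordExt, dif_neg hz, hh]
  have key : ∀ {m : ℤ} {Φ : ℍ[ℝ] × ℍ[ℝ] → ℂ}, Continuous Φ → Φ 0 = 0 →
      (∀ c : ℂ, ‖c‖ = 1 → ∀ p q,
        Φ ((cq c)⁻¹ * p * cq c, (cq c)⁻¹ * q * cq c) = c ^ m * Φ (p, q)) →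
      NearlyHolomorphic m fun z => Φ (coordExt f z, coordExt g z) :=
    fun h1 h2 h3 => nearlyHolomorphic_coordExt h1 h2 h3 hf hg hf' hg'
  have key_conj : ∀ {m : ℤ} {Φ : ℍ[ℝ] × ℍ[ℝ] → ℂ}, Continuous Φ → Φ 0 = 0 →
      (∀ c : ℂ, ‖c‖ = 1 → ∀ p q,
        Φ ((cq c)⁻¹ * p * cq c, (cq c)⁻¹ * q * cq c) = c ^ m * Φ (p, q)) →
      NearlyHolomorphic (-m) fun z => conj (Φ (coordExt f z, coordExt g z)) := by
    intro m Φ h1 h2 h3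
    refine key (Complex.continuous_conj.comp h1) (by simp [h2]) fun c hc p q => ?_
    rw [Function.comp, h3 c hc, map_mul, conj_zpow_of_norm_eq_one hc, Function.comp]
  have hG0 : axisPart 0 0 = 0 := rfl
  have hη0 : twistPart 0 = 0 := by simp [twistPart]; rfl
  have hG1 : ∀ c : ℂ, ‖c‖ = 1 → ∀ p q, axisPart ((cq c)⁻¹ * p * cq c) ((cq c)⁻¹ * q * cq c) =
      c ^ (0 : ℤ) * axisPart p q := fun c hc p q => by
    rw [axisPart_conj_cq hc, zpow_zero, one_mul]
  have hη1 : ∀ c : ℂ, ‖c‖ = 1 → ∀ p, twistPart ((cq c)⁻¹ * p * cq c) =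
      c ^ (2 : ℤ) * twistPart p := fun c hc p => by
    rw [twistPart_conj_cq hc]; rfl
  have nG := key continuous_axisPart hG0 hG1
  have nGc := key_conj continuous_axisPart hG0 hG1
  have nη := key (Φ := fun p => twistPart p.1) (continuous_twistPart.comp continuous_fst) hη0
    fun c hc p _ => hη1 c hc p
  have nηc := key_conj (Φ := fun p => twistPart p.1) (continuous_twistPart.comp continuous_fst) hη0
    fun c hc p _ => hη1 c hc p
  have nθ := key (Φ := fun p => twistPart p.2) (continuous_twistPart.comp continuous_snd) hη0
    fun c hc _ p => hη1 c hc p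
  have nθc := key_conj (Φ := fun p => twistPart p.2) (continuous_twistPart.comp continuous_snd) hη0
    fun c hc _ p => hη1 c hc p
  simp only at nG nGc nη nηc nθ nθc
  have neg : ∀ {m : ℤ} {φ : (Fin 3 × Fin 2 → ℂ) → ℂ}, NearlyHolomorphic m φ →
      NearlyHolomorphic m fun z => -φ z := fun h => by
    simpa only [neg_one_mul] using h.const_mul (-1)
  refine not_skew_invertible (N := fun s t z => skewSymbol (axisPart (coordExt f z) (coordExt g z))
    (twistPart (coordExt f z)) (twistPart (coordExt g z)) s t) ?_ ?_ hδ ?_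
  · intro s t
    fin_cases s <;> fin_cases t <;> simp [degOffset, skewSymbol] <;>
      first
        | exact NearlyHolomorphic.zero _
        | exact nG | exact nGc | exact nη | exact nηc | exact nθ | exact nθc
        | exact neg nη | exact neg nηc | exact neg nθ
  · intro s t z
    rw [hf'.coordExt_quatJ, hg'.coordExt_quatJ, axisPart_conj_j, twistPart_conj_j,
      twistPart_conj_j]
    fin_cases s <;> fin_cases t <;> simp [skewSymbol]
  · intro z hz x t
    refine skewSymbol_lower_bound ?_ x t
    rw [norm_sq_symbol (hre hfre z) (hre hgre z)]
    exact hbound z hz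

end Equivariant

section Projective

lemma hrel_equivalence : Equivalence hrel where
  refl v := ⟨1, one_ne_zero, by simp⟩
  symm := by
    rintro v w ⟨a, ha, h⟩
    refine ⟨a⁻¹, inv_ne_zero ha, ?_⟩
    rw [h]
    funext i
    rw [mul_assoc, mul_inv_cancel₀ ha, mul_one]
  trans := by
    rintro u v w ⟨a, ha, h⟩ ⟨b, hb, h'⟩
    refine ⟨a * b, mul_ne_zero ha hb, ?_⟩
    rw [h', h]
    funext i
    rw [mul_assoc]

lemma hrel_of_mk_eq {v w : V3x} (h : Quot.mk hrel v = Quot.mk hrel w) : hrel v w :=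
  hrel_equivalence.eqvGen_iff.1 (Quot.eq.1 h)

/-- The squared Euclidean norm on `ℍ³`. -/
def quatNormSq (v : Fin 3 → ℍ[ℝ]) : ℝ := ∑ a, Quaternion.normSq (v a)

lemma continuous_quatNormSq : Continuous quatNormSq :=
  continuous_finsetSum _ fun a _ => Quaternion.continuous_normSq.comp (continuous_apply a)

lemma quatNormSq_pos {v : Fin 3 → ℍ[ℝ]} (hv : v ≠ 0) : 0 < quatNormSq v := by
  obtain ⟨a, ha⟩ := Function.ne_iff.1 hv
  exact Finset.sum_pos' (fun _ _ => Quaternion.normSq_nonneg)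
    ⟨a, Finset.mem_univ a, lt_of_le_of_ne Quaternion.normSq_nonneg
      (Quaternion.normSq_ne_zero.2 ha).symm⟩

lemma quatNormSq_mul (v : Fin 3 → ℍ[ℝ]) (q : ℍ[ℝ]) :
    quatNormSq (fun a => v a * q) = quatNormSq v * Quaternion.normSq q := by
  simp only [quatNormSq, map_mul, Finset.sum_mul]

lemma sum_star_mul_self (v : Fin 3 → ℍ[ℝ]) : ∑ a, star (v a) * v a = (quatNormSq v : ℍ[ℝ]) := by
  simp only [Quaternion.star_mul_self]
  exact (map_sum (algebraMap ℝ ℍ[ℝ]) _ _).symm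

/-- The normalised matrix `v x v*` of a quaternionic vector `v` and a quaternion `x`. -/
def outerMatrix (x : ℍ[ℝ]) (v : Fin 3 → ℍ[ℝ]) (a b : Fin 3) : ℍ[ℝ] :=
  (quatNormSq v)⁻¹ • (v a * x * star (v b))

lemma outerMatrix_mul {x q : ℍ[ℝ]} (hq : q ≠ 0)
    (hx : q * x * star q = Quaternion.normSq q • x) (v : Fin 3 → ℍ[ℝ]) :
    outerMatrix x (fun a => v a * q) = outerMatrix x v := by
  funext a b
  have h : v a * q * x * star (v b * q) = Quaternion.normSq q • (v a * x * star (v b)) := by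
    calc v a * q * x * star (v b * q) = v a * (q * x * star q) * star (v b) := by
          rw [star_mul]; simp only [mul_assoc]
      _ = _ := by rw [hx, mul_smul_comm, smul_mul_assoc]
  rw [outerMatrix, outerMatrix, h, quatNormSq_mul, smul_smul, mul_inv, mul_assoc,
    inv_mul_cancel₀ (Quaternion.normSq_ne_zero.2 hq), mul_one]

lemma continuous_outerMatrix (x : ℍ[ℝ]) : Continuous fun v : V3x => outerMatrix x v.1 := by
  refine continuous_pi fun a => continuous_pi fun b => ?_
  refine ((continuous_quatNormSq.comp continuous_subtype_val).inv₀
    fun v => (quatNormSq_pos v.2).ne').smul ?_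
  have h : ∀ c : Fin 3, Continuous fun v : V3x => v.1 c :=
    fun c => (continuous_apply c).comp continuous_subtype_val
  exact ((h a).mul continuous_const).mul (continuous_star.comp (h b))

/-- The orthogonal projection onto a quaternionic line. -/
def lineProj : HP2 → Fin 3 → Fin 3 → ℍ[ℝ] :=
  Quot.lift (fun v => outerMatrix 1 v.1) fun v w ⟨q, hq, hw⟩ => by
    simp only [hw]
    refine (outerMatrix_mul hq ?_ v.1).symm
    rw [mul_one, Quaternion.self_mul_star, ← Quaternion.coe_mul_eq_smul, mul_one]

lemma continuous_lineProj : Continuous lineProj :=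
  continuous_quot_lift _ (continuous_outerMatrix 1)

/-- The skew-Hermitian matrix of a complex line: multiplication by `i` on the quaternionic line
that it spans. -/
def lineAxis : CP5 → Fin 3 → Fin 3 → ℍ[ℝ] :=
  Quot.lift (fun v => outerMatrix (cq Complex.I) v.1) fun v w ⟨c, hc, hw⟩ => by
    simp only [hw]
    refine (outerMatrix_mul (cq_ne_zero hc) ?_ v.1).symm
    ext <;> simp [Quaternion.normSq_def'] <;> ring

lemma continuous_lineAxis : Continuous lineAxis :=
  continuous_quot_lift _ (continuous_outerMatrix _)

lemma outerMatrix_one_mul (v : Fin 3 → ℍ[ℝ]) (a b : Fin 3) :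
    outerMatrix 1 v a b * v b = ((quatNormSq v)⁻¹ * Quaternion.normSq (v b)) • v a := by
  rw [outerMatrix, mul_one, smul_mul_assoc, mul_assoc, Quaternion.star_mul_self,
    Quaternion.mul_coe_eq_smul, smul_smul]

lemma lineProj_injective : Function.Injective lineProj := by
  rintro ⟨v⟩ ⟨w⟩ h
  obtain ⟨b, hb⟩ := Function.ne_iff.1 w.2
  have hb' : (quatNormSq w.1)⁻¹ * Quaternion.normSq (w.1 b) ≠ 0 :=
    mul_ne_zero (inv_ne_zero (quatNormSq_pos w.2).ne') (Quaternion.normSq_ne_zero.2 hb)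
  set r := (quatNormSq w.1)⁻¹ * Quaternion.normSq (w.1 b) with hr
  have hw : w.1 = fun a => v.1 a * ((r⁻¹ * (quatNormSq v.1)⁻¹) • (star (v.1 b) * w.1 b)) := by
    funext a
    have hab : outerMatrix 1 v.1 a b = outerMatrix 1 w.1 a b := congrFun (congrFun h a) b
    have h1 := outerMatrix_one_mul w.1 a b
    rw [← hab, ← hr, outerMatrix, mul_one] at h1
    rw [← inv_smul_smul₀ hb' (w.1 a), ← h1, mul_smul_comm, mul_smul, smul_mul_assoc, mul_assoc]
  refine Quot.sound ⟨_, fun h0 => w.2 ?_, hw⟩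
  rw [hw, h0]
  funext a
  exact mul_zero _

instance : T2Space HP2 := .of_injective_continuous lineProj_injective continuous_lineProj

lemma continuous_mk_hrel : Continuous fun v : V3x => (Quot.mk hrel v : HP2) := continuous_quot_mk

lemma continuous_mk_crel : Continuous fun v : V3x => (Quot.mk crel v : CP5) := continuous_quot_mk

instance : CompactSpace HP2 := by
  have : ProperSpace ℍ[ℝ] := FiniteDimensional.proper_real _
  let g : Metric.sphere (0 : Fin 3 → ℍ[ℝ]) 1 → HP2 := fun v =>
    Quot.mk hrel ⟨v.1, ne_zero_of_mem_unit_sphere v⟩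
  have hg : Continuous g := continuous_mk_hrel.comp (continuous_subtype_val.subtype_mk _)
  have hsurj : Function.Surjective g := by
    rintro ⟨v⟩
    have hv := norm_pos_iff.2 v.2
    refine ⟨⟨‖v.1‖⁻¹ • v.1, ?_⟩, Eq.symm (Quot.sound
      ⟨((‖v.1‖⁻¹ : ℝ) : ℍ[ℝ]), fun h => (inv_pos.2 hv).ne' (congrArg QuaternionAlgebra.re h), ?_⟩)⟩
    · rw [mem_sphere_zero_iff_norm, norm_smul, norm_inv, norm_norm, inv_mul_cancel₀ hv.ne']
    · funext a
      exact (Quaternion.mul_coe_eq_smul _ _).symm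
  exact ⟨hsurj.range_eq ▸ isCompact_range hg⟩

/-- The quaternion `v* A v / |v|²`. -/
def lineForm (A : Fin 3 → Fin 3 → ℍ[ℝ]) (v : Fin 3 → ℍ[ℝ]) : ℍ[ℝ] :=
  (quatNormSq v)⁻¹ • ∑ a, ∑ b, star (v a) * A a b * v b

lemma lineForm_outerMatrix {v : Fin 3 → ℍ[ℝ]} (hv : v ≠ 0) {q : ℍ[ℝ]} (x : ℍ[ℝ]) :
    lineForm (outerMatrix x fun a => v a * q) v = q * x * q⁻¹ := by
  have hn := (quatNormSq_pos hv).ne'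
  have hsum : ∑ a, ∑ b, star (v a) * outerMatrix x (fun a => v a * q) a b * v b =
      (quatNormSq fun a => v a * q)⁻¹ •
        ((∑ a, star (v a) * v a) * (q * x * star q) * ∑ b, star (v b) * v b) := by
    rw [Finset.sum_mul, Finset.sum_mul, Finset.smul_sum]
    refine Finset.sum_congr rfl fun a _ => ?_
    rw [Finset.mul_sum, Finset.smul_sum]
    refine Finset.sum_congr rfl fun b _ => ?_
    rw [outerMatrix, mul_smul_comm, smul_mul_assoc, star_mul]
    simp only [mul_assoc]
  rw [lineForm, hsum, sum_star_mul_self, Quaternion.mul_coe_eq_smul, Quaternion.coe_mul_eq_smul,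
    smul_smul, smul_smul, smul_smul, quatNormSq_mul, Quaternion.inv_def, mul_smul_comm, mul_inv]
  congr 1
  field_simp

lemma continuous_lineForm {X : Type*} [TopologicalSpace X] {A : X → Fin 3 → Fin 3 → ℍ[ℝ]}
    {v : X → V3x} (hA : Continuous A) (hv : Continuous v) :
    Continuous fun x => lineForm (A x) (v x).1 := by
  have h : ∀ c : Fin 3, Continuous fun x => (v x).1 c :=
    fun c => (continuous_apply c).comp (continuous_subtype_val.comp hv)
  refine ((continuous_quatNormSq.comp (continuous_subtype_val.comp hv)).inv₀
    fun x => (quatNormSq_pos (v x).2).ne').smul ?_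
  refine continuous_finsetSum _ fun a _ => continuous_finsetSum _ fun b _ => ?_
  exact ((continuous_star.comp (h a)).mul
    ((continuous_apply b).comp ((continuous_apply a).comp hA))).mul (h b)

lemma exists_lineForm_lineAxis {v : V3x} {e : CP5} (he : twistor e = Quot.mk hrel v) :
    ∃ q : ℍ[ℝ], q ≠ 0 ∧ ∀ (w : V3x) (b : ℍ[ℝ]), b ≠ 0 → (w.1 = fun a => v.1 a * b) →
      lineForm (lineAxis e) w.1 = b⁻¹ * (q * cq Complex.I * q⁻¹) * b := by
  obtain ⟨u⟩ := e
  obtain ⟨q, hq, hu⟩ := hrel_of_mk_eq he.symm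
  refine ⟨q, hq, fun w b hb hw => ?_⟩
  have huw : u.1 = fun a => w.1 a * (b⁻¹ * q) := by
    rw [hu, hw]
    funext a
    rw [mul_assoc, mul_inv_cancel_left₀ hb]
  change lineForm (outerMatrix (cq Complex.I) u.1) w.1 = _
  rw [huw, lineForm_outerMatrix w.2, mul_inv_rev, inv_inv]
  simp only [mul_assoc]

lemma re_conj_cq_I (q : ℍ[ℝ]) : (q * cq Complex.I * q⁻¹).re = 0 := by
  rw [Quaternion.inv_def, mul_smul_comm, Quaternion.re_smul]
  simp
  ring_nf
  simp

open Classical in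
/-- The imaginary quaternion-valued function on nonzero vectors associated with a local section of
the twistor map, cut off by a function on `ℍP²`. -/
def cutoffAxis {U : Set HP2} (s : U → CP5) (ρ : HP2 → ℝ) (v : V3x) : ℍ[ℝ] :=
  if h : Quot.mk hrel v ∈ U then ρ (Quot.mk hrel v) • lineForm (lineAxis (s ⟨_, h⟩)) v.1 else 0

lemma continuous_cutoffAxis {U : Set HP2} (hU : IsOpen U) {s : U → CP5} (hs : Continuous s)
    {ρ : HP2 → ℝ} (hρ : Continuous ρ) (hsupp : tsupport ρ ⊆ U) :
    Continuous (cutoffAxis s ρ) := by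
  rw [continuous_iff_continuousAt]
  intro v
  by_cases hv : Quot.mk hrel v ∈ U
  · have hO : IsOpen {v : V3x | (Quot.mk hrel v : HP2) ∈ U} := hU.preimage continuous_mk_hrel
    refine ContinuousOn.continuousAt (s := {v : V3x | (Quot.mk hrel v : HP2) ∈ U}) ?_
      (hO.mem_nhds hv)
    rw [continuousOn_iff_continuous_domRestrict]
    have h : Set.domRestrict {v : V3x | (Quot.mk hrel v : HP2) ∈ U} (cutoffAxis s ρ) = fun v =>
        ρ (Quot.mk hrel v.1) • lineForm (lineAxis (s ⟨Quot.mk hrel v.1, v.2⟩)) v.1.1 := by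
      funext v
      exact dif_pos v.2
    rw [h]
    exact (hρ.comp (continuous_mk_hrel.comp continuous_subtype_val)).smul (continuous_lineForm
      (continuous_lineAxis.comp (hs.comp
        ((continuous_mk_hrel.comp continuous_subtype_val).subtype_mk _))) continuous_subtype_val)
  · have hev : ∀ᶠ w : V3x in nhds v, cutoffAxis s ρ w = 0 := by
      have := (isClosed_tsupport ρ).isOpen_compl.mem_nhds (fun h => hv (hsupp h))
      filter_upwards [continuous_mk_hrel.continuousAt this] with w hw
      have h0 : ρ (Quot.mk hrel w) = 0 := image_eq_zero_of_notMem_tsupport hw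
      by_cases hwU : (Quot.mk hrel w : HP2) ∈ U
      · rw [cutoffAxis, dif_pos hwU, h0, zero_smul]
      · exact dif_neg hwU
    exact (continuousAt_congr hev).2 continuousAt_const

lemma conjEquivariant_cutoffAxis {U : Set HP2} {s : U → CP5}
    (hs : ∀ x : U, twistor (s x) = x) (ρ : HP2 → ℝ) : ConjEquivariant (cutoffAxis s ρ) := by
  intro v w b hb hw
  have hmk : (Quot.mk hrel v : HP2) = Quot.mk hrel w := Quot.sound ⟨b, hb, hw⟩
  by_cases hv : (Quot.mk hrel v : HP2) ∈ U
  · rw [cutoffAxis, cutoffAxis, dif_pos hv, dif_pos (hmk ▸ hv)]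
    obtain ⟨q, -, h⟩ := exists_lineForm_lineAxis (hs ⟨_, hv⟩)
    have hv1 := h v 1 one_ne_zero (by simp)
    rw [inv_one, one_mul, mul_one] at hv1
    simp only [← hmk]
    rw [hv1, h w b hb hw, mul_smul_comm, smul_mul_assoc]
  · rw [cutoffAxis, cutoffAxis, dif_neg hv, dif_neg (hmk ▸ hv), mul_zero, zero_mul]

lemma exists_cutoffAxis_eq {U : Set HP2} {s : U → CP5} (hs : ∀ x : U, twistor (s x) = x)
    (ρ : HP2 → ℝ) {v : V3x} (hv : Quot.mk hrel v ∈ U) :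
    ∃ q : ℍ[ℝ], q ≠ 0 ∧ cutoffAxis s ρ v = ρ (Quot.mk hrel v) • (q * cq Complex.I * q⁻¹) := by
  obtain ⟨q, hq, h⟩ := exists_lineForm_lineAxis (hs ⟨_, hv⟩)
  refine ⟨q, hq, ?_⟩
  rw [cutoffAxis, dif_pos hv, h v 1 one_ne_zero (by simp), inv_one, one_mul, mul_one]

lemma re_cutoffAxis {U : Set HP2} {s : U → CP5} (hs : ∀ x : U, twistor (s x) = x)
    (ρ : HP2 → ℝ) (v : V3x) : (cutoffAxis s ρ v).re = 0 := by
  by_cases hv : (Quot.mk hrel v : HP2) ∈ U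
  · obtain ⟨q, -, h⟩ := exists_cutoffAxis_eq hs ρ hv
    rw [h, Quaternion.re_smul, re_conj_cq_I, smul_zero]
  · rw [cutoffAxis, dif_neg hv, Quaternion.re_zero]

lemma cutoffAxis_ne_zero {U : Set HP2} {s : U → CP5} (hs : ∀ x : U, twistor (s x) = x)
    {ρ : HP2 → ℝ} {v : V3x} (hv : Quot.mk hrel v ∈ U) (hρ : ρ (Quot.mk hrel v) ≠ 0) :
    cutoffAxis s ρ v ≠ 0 := by
  obtain ⟨q, hq, h⟩ := exists_cutoffAxis_eq hs ρ hv
  rw [h]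
  exact smul_ne_zero hρ
    (mul_ne_zero (mul_ne_zero hq (cq_ne_zero Complex.I_ne_zero)) (inv_ne_zero hq))

lemma not_secatCover_twistor_two : ¬ SecatCover twistor 2 := by
  rintro ⟨U, hU, hcover, hs⟩
  choose s hsc hst using hs
  obtain ⟨ρ, hρ⟩ := PartitionOfUnity.exists_isSubordinate isClosed_univ U hU hcover.ge
  obtain ⟨v, h0, h1⟩ := ConjEquivariant.exists_common_zero
    (continuous_cutoffAxis (hU 0) (hsc 0) (ρ 0).continuous (hρ 0))
    (continuous_cutoffAxis (hU 1) (hsc 1) (ρ 1).continuous (hρ 1))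
    (conjEquivariant_cutoffAxis (hst 0) _) (conjEquivariant_cutoffAxis (hst 1) _)
    (re_cutoffAxis (hst 0) _) (re_cutoffAxis (hst 1) _)
  have hz : ∀ i, cutoffAxis (s i) (ρ i) v = 0 := Fin.forall_fin_two.2 ⟨h0, h1⟩
  obtain ⟨i, hi⟩ := ρ.exists_pos (Set.mem_univ (Quot.mk hrel v : HP2))
  exact cutoffAxis_ne_zero (hst i) (hρ i (subset_tsupport _ hi.ne')) hi.ne' (hz i)

lemma secatCover_twistor_three : SecatCover twistor 3 := by
  refine ⟨fun b => {x | lineProj x b b ≠ 0}, fun b => ?_, ?_, fun b => ?_⟩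
  · exact isOpen_ne_fun ((continuous_apply b).comp ((continuous_apply b).comp continuous_lineProj))
      continuous_const
  · refine Set.eq_univ_of_forall ?_
    rintro ⟨v⟩
    obtain ⟨b, hb⟩ := Function.ne_iff.1 v.2
    refine Set.mem_iUnion.2 ⟨b, ?_⟩
    change (quatNormSq v.1)⁻¹ • (v.1 b * 1 * star (v.1 b)) ≠ 0
    exact smul_ne_zero (inv_ne_zero (quatNormSq_pos v.2).ne')
      (mul_ne_zero (mul_ne_zero hb one_ne_zero) (star_ne_zero.2 hb))
  · refine ⟨fun x => Quot.mk crel ⟨fun a => lineProj x a b, fun h => x.2 (congrFun h b)⟩,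
      continuous_mk_crel.comp (Continuous.subtype_mk (continuous_pi fun a =>
        (continuous_apply b).comp ((continuous_apply a).comp
          (continuous_lineProj.comp continuous_subtype_val))) _), ?_⟩
    rintro ⟨⟨v⟩, hv⟩
    refine Eq.symm (Quot.sound ⟨(quatNormSq v.1)⁻¹ • star (v.1 b), fun h => hv ?_, ?_⟩)
    · change (quatNormSq v.1)⁻¹ • (v.1 b * 1 * star (v.1 b)) = 0
      rw [← mul_smul_comm, h, mul_zero]
    · funext a
      change (quatNormSq v.1)⁻¹ • (v.1 a * 1 * star (v.1 b)) = _
      rw [mul_one, mul_smul_comm]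

end Projective

/-- The (normalized) sectional category of the twistor map is exactly `2`:
`ℍP²` is covered by three open sets over each of which `twistor` has a
continuous local section, but there is no such cover by two open sets. -/
theorem secat_twistor_eq_two : SecatCover twistor 3 ∧ ¬ SecatCover twistor 2 := by
  exact ⟨secatCover_twistor_three, not_secatCover_twistor_two⟩

end
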